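/- arXiv:2102.11104 — 3 statements merged into one kernel-verified Lean document; each statement's English description precedes it below -/
import Mathlib

section
/- Let H be a simple graph with chromatic number 3, and let g be the smallest positive integer such that there is no graph homomorphism from H to the cycle C_{2g+1}. Then δ*_χ(H, 2) = 2/(2g+1). -/
open SimpleGraph

/-- `H` has a copy in `G`: an injective graph homomorphism from `H` to `G`,
i.e. `G` contains a subgraph isomorphic to `H`. -/
def Copies {α β : Type*} (H : SimpleGraph α) (G : SimpleGraph β) : Prop :=
  ∃ f : H →g G, Function.Injective f

/-- `deltaStar H k` is the infimum of all `c ≥ 0` such that: for every `ε > 0` there is `N`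
such that every `H`-free graph `G` on `n ≥ N` vertices with minimum degree at least `c * n`
has a spanning subgraph, obtained by deleting at most `ε * n ^ 2` edges, that is
`k`-colourable. -/
noncomputable def deltaStar {α : Type*} (H : SimpleGraph α) (k : ℕ) : ℝ :=
  sInf {c : ℝ | 0 ≤ c ∧ ∀ ε : ℝ, 0 < ε → ∃ N : ℕ, ∀ n : ℕ, N ≤ n →
    ∀ G : SimpleGraph (Fin n), ¬ Copies H G →
      (∀ v, c * n ≤ ((G.neighborSet v).ncard : ℝ)) →
      ∃ G' : SimpleGraph (Fin n), G' ≤ G ∧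
        ((G.edgeSet \ G'.edgeSet).ncard : ℝ) ≤ ε * n ^ 2 ∧ G'.Colorable k}

open Classical in
/-- number of elements of a finite type satisfying a predicate, as a real -/
noncomputable def cnt {Y : Type*} [Fintype Y] (P : Y → Prop) : ℝ :=
  ((Finset.univ.filter P).card : ℝ)

open Classical in
lemma cnt_nonneg {Y : Type*} [Fintype Y] (P : Y → Prop) : 0 ≤ cnt P := by
  unfold cnt; positivity

open Classical in
lemma cnt_mono {Y : Type*} [Fintype Y] {P Q : Y → Prop} (h : ∀ y, P y → Q y) :
    cnt P ≤ cnt Q := by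
  unfold cnt
  exact_mod_cast Finset.card_le_card (fun y hy => by simpa using h y (by simpa using hy))

open Classical in
lemma cnt_le_card {Y : Type*} [Fintype Y] (P : Y → Prop) : cnt P ≤ Fintype.card Y := by
  unfold cnt
  exact_mod_cast Finset.card_le_univ _

open Classical in
lemma cnt_eq_sum {Y : Type*} [Fintype Y] (P : Y → Prop) :
    cnt P = ∑ y, if P y then (1 : ℝ) else 0 := by
  unfold cnt
  simp

open Classical in
lemma cnt_not {Y : Type*} [Fintype Y] (P : Y → Prop) :
    cnt P + cnt (fun y => ¬ P y) = Fintype.card Y := by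
  unfold cnt
  rw [← Finset.card_univ]
  have h := Finset.card_filter_add_card_filter_not (s := Finset.univ) P
  norm_cast
  convert h

open Classical in
lemma sum_cnt_comm {Y Z : Type*} [Fintype Y] [Fintype Z] (R : Y → Z → Prop) :
    ∑ y, cnt (fun z => R y z) = ∑ z, cnt (fun y => R y z) := by
  simp only [cnt_eq_sum]
  exact Finset.sum_comm

open Classical in
lemma cnt_inj {Y Z : Type*} [Fintype Y] [Fintype Z] {P : Y → Prop} {Q : Z → Prop} (f : Y → Z)
    (hf : Function.Injective f) (h : ∀ y, P y → Q (f y)) : cnt P ≤ cnt Q := by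
  unfold cnt
  exact_mod_cast Finset.card_le_card_of_injOn f (fun y hy => by simpa using h y (by simpa using hy))
    hf.injOn

open Classical in
lemma exists_of_cnt_pos {Y : Type*} [Fintype Y] {P : Y → Prop} (h : 0 < cnt P) : ∃ y, P y := by
  unfold cnt at h
  obtain ⟨y, hy⟩ := Finset.card_pos.1 (by exact_mod_cast h : 0 < (Finset.univ.filter P).card)
  exact ⟨y, by simpa using hy⟩

open Classical in
/-- lower bound for a sum -/
lemma sum_ge_cnt_mul {Y : Type*} [Fintype Y] (P : Y → Prop) (f : Y → ℝ) (b : ℝ)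
    (h0 : ∀ y, 0 ≤ f y) (h : ∀ y, P y → b ≤ f y) : cnt P * b ≤ ∑ y, f y := by
  rw [cnt_eq_sum, Finset.sum_mul]
  apply Finset.sum_le_sum
  intro y _
  split_ifs with hy
  · simpa using h y hy
  · simpa using h0 y

open Classical in
lemma sum_le_cnt_mul_add {Y : Type*} [Fintype Y] (P : Y → Prop) (f : Y → ℝ) (a b : ℝ)
    (hb : 0 ≤ b)
    (h0 : ∀ y, f y ≤ a) (h : ∀ y, ¬ P y → f y ≤ b) :
    ∑ y, f y ≤ cnt P * a + Fintype.card Y * b := by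
  have : (Fintype.card Y : ℝ) * b = ∑ y : Y, b := by simp
  rw [cnt_eq_sum, Finset.sum_mul, this, ← Finset.sum_add_distrib]
  apply Finset.sum_le_sum
  intro y _
  split_ifs with hy
  · have := h0 y
    linarith
  · simpa using h y hy

/-- pigeonhole -/
lemma exists_cnt_ge {Y Z : Type*} [Fintype Y] [Fintype Z] (R : Y → Z → Prop) (P : Y → Prop)
    (a b : ℝ) (hb : 0 < b) (ha : 0 < a)
    (hP : a ≤ cnt P) (h : ∀ y, P y → b ≤ cnt (R y)) :
    ∃ z, (a * b) / Fintype.card Z ≤ cnt (fun y => R y z) := by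
  have h1 : a * b ≤ ∑ z, cnt (fun y => R y z) := by
    rw [← sum_cnt_comm]
    refine le_trans ?_ (sum_ge_cnt_mul P _ b (fun y => cnt_nonneg _) h)
    gcongr
  have hne : Nonempty Z := by
    by_contra hne
    rw [not_nonempty_iff] at hne
    simp at h1
    nlinarith [mul_pos ha hb]
  by_contra! hcon
  have : ∑ z, cnt (fun y => R y z) < ∑ z : Z, (a * b) / Fintype.card Z :=
    Finset.sum_lt_sum_of_nonempty Finset.univ_nonempty (fun z _ => hcon z)
  have hc : (Fintype.card Z : ℝ) ≠ 0 := by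
    exact_mod_cast Fintype.card_ne_zero
  simp only [Finset.sum_const, Finset.card_univ, nsmul_eq_mul] at this
  rw [mul_div_cancel₀ _ hc] at this
  linarith

open Classical in
lemma cnt_emb {V : Type*} [Fintype V] (D : V → Prop) (t : ℕ) :
    ((cnt D) - t) ^ t ≤ cnt (fun T : Fin t ↪ V => ∀ j, D (T j)) ∨ cnt D < t := by
  by_cases hlt : cnt D < t
  · exact Or.inr hlt
  left
  have h1 : Fintype.card (Fin t ↪ {v // D v}) ≤ (Finset.univ.filter
      (fun T : Fin t ↪ V => ∀ j, D (T j))).card := by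
    rw [← Finset.card_univ]
    refine Finset.card_le_card_of_injOn
      (fun T => T.trans (Function.Embedding.subtype _)) ?_ ?_
    · intro T _
      simp
      intro j
      exact (T j).2
    · intro T _ T' _ h
      ext j
      have := congrArg (fun e : Fin t ↪ V => e j) h
      simpa using this
  rw [Fintype.card_embedding_eq] at h1
  have hD : cnt D = (Fintype.card {v // D v} : ℝ) := by
    unfold cnt; rw [Fintype.card_subtype]
  have h2 := Nat.pow_sub_le_descFactorial (Fintype.card {v // D v}) t
  rw [hD] at hlt ⊢
  have hle : t ≤ Fintype.card {v // D v} := by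
    have := not_lt.1 hlt
    exact_mod_cast this
  have h3 : (Fintype.card {v // D v} - t) ^ t ≤ (Finset.univ.filter
      (fun T : Fin t ↪ V => ∀ j, D (T j))).card := by
    refine le_trans ?_ (le_trans h2 (by simpa using h1))
    gcongr
    omega
  unfold cnt
  rw [← Nat.cast_sub hle]
  norm_cast
  convert h3

open Classical in
theorem box (t : ℕ) (m : ℕ) : ∀ (η : ℝ), 0 < η → ∀ s : ℕ, ∃ N : ℕ,
    ∀ (V : Type) [Fintype V], N ≤ Fintype.card V → ∀ (A : (Fin m → V) → Prop),
    η * (Fintype.card V : ℝ) ^ m ≤ cnt A → ∀ X : Finset V, X.card ≤ s →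
    ∃ T : Fin m → Fin t → V, (∀ i j i' j', T i j = T i' j' → i = i' ∧ j = j') ∧
      (∀ i j, T i j ∉ X) ∧ ∀ c : Fin m → Fin t, A (fun i => T i (c i)) := by
  induction m with
  | zero =>
    intro η hη s
    refine ⟨0, fun V _ _ A hA X _ => ⟨fun i => i.elim0, fun i => i.elim0, fun i => i.elim0, ?_⟩⟩
    intro c
    obtain ⟨y, hy⟩ := exists_of_cnt_pos (lt_of_lt_of_le (by simpa using hη) hA)
    convert hy
  | succ m ih =>
    intro η hη s
    obtain ⟨N, hN⟩ := ih ((η / 2) * (η / 4) ^ t) (by positivity) (s + t)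
    obtain ⟨N', hN'⟩ := exists_nat_gt ((s + t) / (η / 4))
    refine ⟨max N (N' + 1), fun V _ hV A hA X hX => ?_⟩
    have hV1 : N ≤ Fintype.card V := le_trans (le_max_left _ _) hV
    have hV2 : N' + 1 ≤ Fintype.card V := le_trans (le_max_right _ _) hV
    set n : ℝ := ((Fintype.card V : ℕ) : ℝ) with hn
    have hnpos : 0 < n := by
      have : 0 < Fintype.card V := by omega
      rw [hn]; exact_mod_cast this
    have hnbig : (s + t : ℝ) ≤ η / 4 * n := by
      have h1 : (N' : ℝ) ≤ n := by
        have : N' ≤ Fintype.card V := by omega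
        rw [hn]; exact_mod_cast this
      have h2 := lt_of_lt_of_le hN' h1
      rw [div_lt_iff₀ (by positivity)] at h2
      linarith
    -- degrees
    have hsum : η * n ^ (m + 1) ≤ ∑ y : Fin m → V, cnt (fun v => A (Fin.cons v y)) := by
      refine hA.trans (le_of_eq ?_)
      rw [cnt_eq_sum, ← (Fin.consEquiv (fun _ => V)).sum_comp, Fintype.sum_prod_type_right]
      simp only [cnt_eq_sum]
      rfl
    have hcardm : (Fintype.card (Fin m → V) : ℝ) = n ^ m := by simp [hn]
    have hP : (η / 2) * n ^ m ≤ cnt (fun y : Fin m → V =>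
        η / 2 * n ≤ cnt (fun v => A (Fin.cons v y))) := by
      have := sum_le_cnt_mul_add (fun y : Fin m → V =>
        η / 2 * n ≤ cnt (fun v => A (Fin.cons v y)))
        (fun y => cnt (fun v => A (Fin.cons v y))) n (η / 2 * n) (by positivity)
        (fun y => cnt_le_card _) (fun y hy => (not_le.1 hy).le)
      rw [hcardm] at this
      have h3 := hsum.trans this
      have h4 : (η / 2 * n ^ m) * n ≤ cnt (fun y : Fin m → V =>
        η / 2 * n ≤ cnt (fun v => A (Fin.cons v y))) * n := by
        rw [pow_succ] at h3
        linarith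
      exact le_of_mul_le_mul_right h4 hnpos
    obtain ⟨T0, hT0⟩ := exists_cnt_ge
      (fun (y : Fin m → V) (T : {T : Fin t ↪ V // ∀ j, T j ∉ X}) => ∀ j, A (Fin.cons (T.1 j) y))
      _ ((η / 2) * n ^ m) ((η / 4 * n) ^ t) (by positivity) (by positivity) hP (by
        intro y hy
        have hD : η / 4 * n + t ≤ cnt (fun v => A (Fin.cons v y) ∧ v ∉ X) := by
          have : cnt (fun v => A (Fin.cons v y)) ≤ cnt (fun v => A (Fin.cons v y) ∧ v ∉ X) + s := by
            have h5 : cnt (fun v => A (Fin.cons v y)) ≤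
              cnt (fun v => A (Fin.cons v y) ∧ v ∉ X) + (X.card : ℝ) := by
              unfold cnt
              norm_cast
              rw [← Finset.card_union_of_disjoint]
              · apply Finset.card_le_card
                intro v hv
                simp at hv ⊢
                tauto
              · rw [Finset.disjoint_left]
                intro v hv
                simp at hv
                exact hv.2
            have : (X.card : ℝ) ≤ s := by exact_mod_cast hX
            linarith
          linarith
        rcases cnt_emb (fun v => A (Fin.cons v y) ∧ v ∉ X) t with h | h
        · have h6 : (η / 4 * n) ^ t ≤ (cnt (fun v => A (Fin.cons v y) ∧ v ∉ X) - t) ^ t := by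
            apply pow_le_pow_left₀ (by positivity)
            linarith
          refine h6.trans (h.trans ?_)
          unfold cnt
          norm_cast
          refine Finset.card_le_card_of_surjOn (fun T => T.1) ?_
          intro T hT
          simp at hT ⊢
          exact ⟨fun j => (hT j).1, fun j => (hT j).2⟩
        · have : 0 < η / 4 * n := by positivity
          linarith)
    have hcardZ : (Fintype.card {T : Fin t ↪ V // ∀ j, T j ∉ X} : ℝ) ≤ n ^ t := by
      have : Fintype.card {T : Fin t ↪ V // ∀ j, T j ∉ X} ≤ Fintype.card (Fin t → V) :=
        Fintype.card_le_of_injective (fun T => (T.1 : Fin t → V)) (by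
          intro T T' h
          exact Subtype.ext (DFunLike.coe_injective h))
      have h2 : (Fintype.card {T : Fin t ↪ V // ∀ j, T j ∉ X} : ℝ) ≤ Fintype.card (Fin t → V) := by
        exact_mod_cast this
      simpa [hn] using h2
    have hcardZ0 : (0 : ℝ) < Fintype.card {T : Fin t ↪ V // ∀ j, T j ∉ X} := by
      have : 0 < Fintype.card {T : Fin t ↪ V // ∀ j, T j ∉ X} := Fintype.card_pos_iff.2 ⟨T0⟩
      exact_mod_cast this
    have hB : (η / 2) * (η / 4) ^ t * n ^ m ≤ cnt (fun y => ∀ j, A (Fin.cons (T0.1 j) y)) := by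
      refine le_trans ?_ hT0
      rw [le_div_iff₀ hcardZ0]
      calc (η / 2) * (η / 4) ^ t * n ^ m * Fintype.card {T : Fin t ↪ V // ∀ j, T j ∉ X}
          ≤ (η / 2) * (η / 4) ^ t * n ^ m * n ^ t := by gcongr
        _ = _ := by rw [mul_pow]; ring
    obtain ⟨T, hTi, hTX, hTA⟩ := hN V hV1 _ hB (X ∪ Finset.univ.map T0.1) (by
      refine (Finset.card_union_le _ _).trans ?_
      simpa using hX)
    refine ⟨Fin.cons T0.1 T, ?_, ?_, ?_⟩
    · intro i j i' j'
      induction i using Fin.cases with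
      | zero =>
        induction i' using Fin.cases with
        | zero => simp
        | succ i' =>
          simp only [Fin.cons_zero, Fin.cons_succ]
          intro h
          exact absurd (by simp [← h]) (hTX i' j')
      | succ i =>
        induction i' using Fin.cases with
        | zero =>
          simp only [Fin.cons_zero, Fin.cons_succ]
          intro h
          exact absurd (by simp [h]) (hTX i j)
        | succ i' =>
          simp only [Fin.cons_succ, Fin.succ_inj]
          exact hTi i j i' j'
    · intro i j
      induction i using Fin.cases with
      | zero => simpa using T0.2 j
      | succ i =>
        have := hTX i j
        simp at this ⊢
        exact this.1
    · intro c
      have := hTA (fun i => c i.succ) (c 0)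
      convert this using 1
      funext i
      induction i using Fin.cases with
      | zero => simp
      | succ i => simp

open Classical in
theorem box' (t : ℕ) (ι : Type) [Fintype ι] (η : ℝ) (hη : 0 < η) : ∃ N : ℕ,
    ∀ (V : Type) [Fintype V], N ≤ Fintype.card V → ∀ (A : (ι → V) → Prop),
    η * (Fintype.card V : ℝ) ^ (Fintype.card ι) ≤ cnt A →
    ∃ T : ι → Fin t → V, (∀ i j i' j', T i j = T i' j' → i = i' ∧ j = j') ∧
      ∀ c : ι → Fin t, A (fun i => T i (c i)) := by
  obtain ⟨N, hN⟩ := box t (Fintype.card ι) η hη 0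
  refine ⟨N, fun V _ hV A hA => ?_⟩
  let e := Fintype.equivFin ι
  obtain ⟨T, h1, _, h3⟩ := hN V hV (fun y => A (y ∘ e)) (hA.trans
    (cnt_inj (fun x => x ∘ e.symm) (fun x y h => by
      funext i
      have := congrFun h (e i)
      simpa using this) (fun y hy => by
        have : (y ∘ e.symm) ∘ e = y := by funext i; simp
        rw [this]; exact hy))) ∅ (by simp)
  refine ⟨fun i => T (e i), ?_, ?_⟩
  · intro i j i' j' h
    have := h1 _ _ _ _ h
    exact ⟨e.injective this.1, this.2⟩
  · intro c
    have := h3 (c ∘ e.symm)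
    convert this using 1
    funext i
    simp

/-- there is a closed walk of odd length at most `l` -/
def OddW {ι : Type*} (F : SimpleGraph ι) (l : ℕ) : Prop :=
  ∃ u, ∃ w : F.Walk u u, Odd w.length ∧ w.length ≤ l

lemma walk_seg {ι : Type*} {F : SimpleGraph ι} {u v : ι} (w : F.Walk u v) (i d : ℕ)
    (h : i + d ≤ w.length) :
    ∃ q : F.Walk (w.getVert i) (w.getVert (i + d)), q.length = d := by
  induction d with
  | zero => exact ⟨Walk.nil, rfl⟩
  | succ d ih =>
    obtain ⟨q, hq⟩ := ih (by omega)
    exact ⟨q.concat (w.adj_getVert_succ (by omega)), by simp [hq]⟩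

lemma oddW_close {ι : Type*} {F : SimpleGraph ι} {a b v : ι} (q : F.Walk a b)
    (ha : F.Adj v a) (hb : F.Adj v b) (ho : Odd q.length) (l : ℕ) (hl : q.length + 2 ≤ l) :
    OddW F l := by
  refine ⟨v, Walk.cons ha (q.concat hb.symm), ?_, ?_⟩
  · simp only [Walk.length_cons, Walk.length_concat]
    exact ho.add_even (by decide : Even 2)
  · simp; omega

lemma shorten {ι : Type*} {F : SimpleGraph ι} {u v : ι} (w : F.Walk u u)
    (ho : Odd w.length) (h5 : 5 ≤ w.length) {i j k : ℕ} (hij : i < j) (hjk : j < k)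
    (hk : k < w.length) (hi' : F.Adj v (w.getVert i)) (hj' : F.Adj v (w.getVert j))
    (hk' : F.Adj v (w.getVert k)) : OddW F (w.length - 2) := by
  obtain ⟨q1, h1⟩ := walk_seg w i (j - i) (by omega)
  obtain ⟨q2, h2⟩ := walk_seg w j (k - j) (by omega)
  obtain ⟨q3, h3⟩ := walk_seg w k (w.length - k) (by omega)
  obtain ⟨q4, h4⟩ := walk_seg w 0 i (by omega)
  have e1 : i + (j - i) = j := by omega
  have e2 : j + (k - j) = k := by omega
  have e3 : k + (w.length - k) = w.length := by omega
  rw [Nat.odd_iff] at ho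
  by_cases c1 : (j - i) % 2 = 1 ∧ j - i + 4 ≤ w.length
  · refine oddW_close q1 hi' (by rw [e1]; exact hj') ?_ _ ?_
    · rw [Nat.odd_iff]; omega
    · omega
  by_cases c2 : (k - j) % 2 = 1 ∧ k - j + 4 ≤ w.length
  · refine oddW_close q2 hj' (by rw [e2]; exact hk') ?_ _ ?_
    · rw [Nat.odd_iff]; omega
    · omega
  · have es : w.getVert (k + (w.length - k)) = w.getVert 0 := by rw [e3]; simp
    have ee : w.getVert (0 + i) = w.getVert i := by simp
    have hl : ((q3.copy rfl es).append q4).length = w.length - k + i := by simp [h3, h4]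
    refine oddW_close ((q3.copy rfl es).append q4) hk' (by rw [ee]; exact hi') ?_ _ ?_
    · rw [hl, Nat.odd_iff]; omega
    · rw [hl]; omega

lemma OddW.mono {ι : Type*} {F : SimpleGraph ι} {l l' : ℕ} (h : OddW F l) (hl : l ≤ l') :
    OddW F l' := by
  obtain ⟨u, w, h1, h2⟩ := h
  exact ⟨u, w, h1, h2.trans hl⟩

lemma cycle_hom {ι : Type*} {F : SimpleGraph ι} {u : ι} (w : F.Walk u u) :
    Nonempty (cycleGraph w.length →g F) := by
  have key : ∀ a b : Fin w.length, (a - b).val = 1 → F.Adj (w.getVert b) (w.getVert a) := by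
    intro a b h
    rw [Fin.sub_def] at h
    simp only at h
    have ha := a.2
    have hb := b.2
    by_cases hab : (b : ℕ) ≤ a
    · have : w.length - b + a = w.length + (a - b) := by omega
      rw [this, Nat.add_mod_left, Nat.mod_eq_of_lt (by omega)] at h
      have : (a : ℕ) = b + 1 := by omega
      rw [this]
      exact w.adj_getVert_succ hb
    · rw [Nat.mod_eq_of_lt (by omega)] at h
      have h1 : (a : ℕ) = 0 := by omega
      have h2 : (b : ℕ) + 1 = w.length := by omega
      have := w.adj_getVert_succ hb
      rw [h2] at this
      rw [h1]
      simpa using this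
  refine ⟨⟨fun i => w.getVert i, ?_⟩⟩
  intro a b hab
  rw [cycleGraph_adj'] at hab
  rcases hab with h | h
  · exact (key a b h).symm
  · exact key b a h

open Classical in
lemma prod_lower {Y Z : Type*} [Fintype Y] [Fintype Z] (P : Y → Prop) (Q : Y → Z → Prop) (b : ℝ)
    (h : ∀ y, P y → b ≤ cnt (Q y)) : cnt P * b ≤ cnt (fun p : Y × Z => Q p.1 p.2) := by
  refine (sum_ge_cnt_mul P _ b (fun y => cnt_nonneg _) h).trans (le_of_eq ?_)
  simp only [cnt_eq_sum]
  rw [Fintype.sum_prod_type]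

open Classical in
/-- a positive proportion of tuples contains a short odd closed walk -/
def DenseOdd {V : Type} [Fintype V] (G : SimpleGraph V) (ι : Type) [Fintype ι] (η : ℝ) (l : ℕ) :
    Prop :=
  η * (Fintype.card V : ℝ) ^ (Fintype.card ι) ≤ cnt (fun x : ι → V => OddW (G.comap x) l)

open Classical in
lemma descent_point {V ι : Type} [Fintype V] [Nonempty V] (G : SimpleGraph V) (c : ℝ) (g : ℕ)
    (hg : 2 ≤ g) (hc1 : c ≤ 1) (hdeg : ∀ v, c * Fintype.card V ≤ cnt (G.Adj v)) (l : ℕ)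
    (x : ι → V) (hx : OddW (G.comap x) l) :
    (c - 2 / (2 * g + 1)) * Fintype.card V ≤
      cnt (fun v => OddW (G.comap (fun o : Option ι => o.elim v x)) (max (l - 2) (2 * g - 1))) := by
  obtain ⟨u, w, ho, hl⟩ := hx
  have hn : (0 : ℝ) < Fintype.card V := by exact_mod_cast Fintype.card_pos
  let φ : ∀ v, (G.comap x) →g (G.comap (fun o : Option ι => o.elim v x)) :=
    fun v => ⟨some, fun h => h⟩
  by_cases hs : w.length ≤ 2 * g - 1
  · have : cnt (fun v => OddW (G.comap (fun o : Option ι => o.elim v x)) (max (l - 2) (2 * g - 1)))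
      = Fintype.card V := by
      unfold cnt
      rw [Finset.filter_true_of_mem]
      · simp
      · intro v _
        exact ⟨_, w.map (φ v), by simpa using ho, by simp; omega⟩
    rw [this]
    have h2 : (0 : ℝ) ≤ 2 / (2 * g + 1) := by positivity
    nlinarith
  · have hL : 2 * g + 1 ≤ w.length := by
      rw [Nat.odd_iff] at ho; omega
    set L := w.length with hLdef
    have h1 : (L : ℝ) * (c * Fintype.card V) ≤
        ∑ v, cnt (fun k : Fin L => G.Adj (x (w.getVert k)) v) := by
      rw [sum_cnt_comm (fun (v : V) (k : Fin L) => G.Adj (x (w.getVert k)) v)]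
      have : (L : ℝ) * (c * Fintype.card V) = ∑ k : Fin L, c * (Fintype.card V : ℝ) := by simp
      rw [this]
      exact Finset.sum_le_sum (fun k _ => hdeg _)
    have h2 := sum_le_cnt_mul_add (fun v => 3 ≤ (Finset.univ.filter
        (fun k : Fin L => G.Adj (x (w.getVert k)) v)).card)
      (fun v => cnt (fun k : Fin L => G.Adj (x (w.getVert k)) v)) L 2 (by norm_num)
      (fun v => (cnt_le_card _).trans (by simp)) (fun v hv => by
        unfold cnt
        have : (Finset.univ.filter (fun k : Fin L => G.Adj (x (w.getVert k)) v)).card ≤ 2 := by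
          omega
        exact_mod_cast this)
    have h3 : cnt (fun v => 3 ≤ (Finset.univ.filter
        (fun k : Fin L => G.Adj (x (w.getVert k)) v)).card) ≤
      cnt (fun v => OddW (G.comap (fun o : Option ι => o.elim v x)) (max (l - 2) (2 * g - 1))) := by
      apply cnt_mono
      intro v hv
      let e := Finset.orderEmbOfCardLe _ hv
      have he : ∀ a : Fin 3, G.Adj (x (w.getVert (e a))) v := fun a => by
        simpa using Finset.orderEmbOfCardLe_mem _ hv a
      have e01 : e 0 < e 1 := e.strictMono (by decide)
      have e12 : e 1 < e 2 := e.strictMono (by decide)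
      have he' : ∀ a : Fin 3, (G.comap (fun o : Option ι => o.elim v x)).Adj none
          ((w.map (φ v)).getVert (e a)) := fun a => by
        rw [Walk.getVert_map]
        exact (he a).symm
      have := shorten (w.map (φ v)) (by simpa using ho) (by rw [Walk.length_map]; omega)
        (i := e 0) (j := e 1) (k := e 2)
        e01 e12 (by rw [Walk.length_map]; exact (e 2).2) (he' 0) (he' 1) (he' 2)
      refine this.mono ?_
      rw [Walk.length_map]
      omega
    refine le_trans ?_ h3
    have hLr : (2 * g + 1 : ℝ) ≤ L := by exact_mod_cast hL
    have hLp : (0 : ℝ) < L := by linarith [(Nat.cast_nonneg g : (0:ℝ) ≤ g)]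
    have h4 : (2 : ℝ) / L ≤ 2 / (2 * g + 1) := by gcongr
    have h5 := h1.trans h2
    have h6 : (c - 2 / L) * Fintype.card V ≤ cnt (fun v => 3 ≤ (Finset.univ.filter
        (fun k : Fin L => G.Adj (x (w.getVert k)) v)).card) := by
      have : ((c - 2 / L) * Fintype.card V) * L ≤ cnt (fun v => 3 ≤ (Finset.univ.filter
        (fun k : Fin L => G.Adj (x (w.getVert k)) v)).card) * L := by
        have : ((c - 2 / L) * Fintype.card V) * L = L * (c * Fintype.card V) -
          Fintype.card V * 2 := by field_simp
        rw [this]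
        linarith
      exact le_of_mul_le_mul_right this hLp
    refine le_trans ?_ h6
    gcongr

open Classical in
lemma descent {V : Type} [Fintype V] [Nonempty V] (G : SimpleGraph V) (c : ℝ) (g : ℕ)
    (hg : 2 ≤ g) (hc1 : c ≤ 1) (hc : 2 / (2 * g + 1) < c)
    (hdeg : ∀ v, c * Fintype.card V ≤ cnt (G.Adj v)) (l : ℕ)
    (ι : Type) [Fintype ι] (η : ℝ) (h : DenseOdd G ι η l) :
    DenseOdd G (Option ι) (η * (c - 2 / (2 * g + 1))) (max (l - 2) (2 * g - 1)) := by
  unfold DenseOdd at *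
  have hn : (0 : ℝ) < Fintype.card V := by exact_mod_cast Fintype.card_pos
  have h1 := prod_lower (fun x : ι → V => OddW (G.comap x) l)
    (fun x v => OddW (G.comap (fun o : Option ι => o.elim v x)) (max (l - 2) (2 * g - 1)))
    ((c - 2 / (2 * g + 1)) * Fintype.card V)
    (fun x hx => descent_point G c g hg hc1 hdeg l x hx)
  have h2 : cnt (fun p : (ι → V) × V => OddW (G.comap (fun o : Option ι => o.elim p.2 p.1))
      (max (l - 2) (2 * g - 1))) ≤
      cnt (fun x : Option ι → V => OddW (G.comap x) (max (l - 2) (2 * g - 1))) := by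
    refine cnt_inj (fun p o => o.elim p.2 p.1) ?_ (fun p hp => hp)
    intro p q hpq
    refine Prod.ext ?_ ?_
    · funext i
      simpa using congrFun hpq (some i)
    · simpa using congrFun hpq none
  refine le_trans ?_ ((h1.trans h2).trans (le_of_eq (by congr!)))
  have h3 : 0 ≤ (c - 2 / (2 * g + 1)) * (Fintype.card V : ℝ) :=
    mul_nonneg (by linarith) hn.le
  calc _ = (η * (Fintype.card V : ℝ) ^ (Fintype.card ι)) *
        ((c - 2 / (2 * g + 1)) * Fintype.card V) := by
        rw [Fintype.card_option, pow_succ]; ring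
    _ ≤ _ := mul_le_mul_of_nonneg_right h h3

open Classical in
lemma descent_iter (c : ℝ) (g : ℕ)
    (hg : 2 ≤ g) (hc1 : c ≤ 1) (hc : 2 / (2 * g + 1) < c) (l : ℕ) :
    ∀ (ι : Type) [Fintype ι] (η : ℝ), 0 < η →
    ∃ (κ : Type) (_ : Fintype κ) (η' : ℝ), 0 < η' ∧
    ∀ (V : Type) [Fintype V] [Nonempty V] (G : SimpleGraph V),
      (∀ v, c * Fintype.card V ≤ cnt (G.Adj v)) → DenseOdd G ι η l →
      DenseOdd G κ η' (2 * g - 1) := by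
  induction l using Nat.strong_induction_on with
  | _ l ih =>
    intro ι _ η hη
    by_cases hl : l ≤ 2 * g - 1
    · refine ⟨ι, inferInstance, η, hη, fun V _ _ G _ h => le_trans h ?_⟩
      exact cnt_mono (fun x hx => hx.mono hl)
    · obtain ⟨κ, i, η', h1, h2⟩ := ih (max (l - 2) (2 * g - 1)) (by omega) (Option ι)
        (η * (c - 2 / (2 * g + 1))) (mul_pos hη (by linarith))
      exact ⟨κ, i, η', h1, fun V _ _ G hd h => h2 V G hd (descent G c g hg hc1 hc hd l ι η h)⟩

lemma final_embed {α : Type*} [Fintype α] (H : SimpleGraph α) (g : ℕ)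
    (hmin : ∀ g' : ℕ, 0 < g' → g' < g → Nonempty (H →g cycleGraph (2 * g' + 1)))
    (κ : Type) [Fintype κ] (η : ℝ) (hη : 0 < η) :
    ∃ N : ℕ, ∀ (V : Type) [Fintype V] (G : SimpleGraph V), N ≤ Fintype.card V →
      DenseOdd G κ η (2 * g - 1) → Copies H G := by
  classical
  obtain ⟨N, hN⟩ := box' (Fintype.card α) κ (η / (Fintype.card (α → κ) + 1)) (by positivity)
  refine ⟨N + 1, fun V _ G hV hd => ?_⟩
  have hn : (0 : ℝ) < Fintype.card V := by
    have : 0 < Fintype.card V := by omega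
    exact_mod_cast this
  obtain ⟨φ, hφ⟩ := exists_cnt_ge
    (fun (x : κ → V) (φ : α → κ) => ∀ a b, H.Adj a b → G.Adj (x (φ a)) (x (φ b)))
    (fun x : κ → V => OddW (G.comap x) (2 * g - 1))
    (η * (Fintype.card V : ℝ) ^ (Fintype.card κ)) 1 one_pos (by positivity)
    (hd.trans (le_of_eq (by congr!))) (by
      intro x hx
      obtain ⟨u, w, ho, hl⟩ := hx
      obtain ⟨k, hk⟩ := ho
      have hk0 : 0 < k := by
        rcases Nat.eq_zero_or_pos k with h | h
        · subst h
          have := w.adj_getVert_succ (i := 0) (by omega)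
          have h2 : w.getVert (0 + 1) = u := by
            have := w.getVert_length
            rwa [hk] at this
          rw [h2, Walk.getVert_zero] at this
          exact absurd this (SimpleGraph.irrefl _)
        · exact h
      obtain ⟨f1⟩ := hmin k hk0 (by omega)
      obtain ⟨f2⟩ := cycle_hom w
      rw [hk] at f2
      have : (0 : ℝ) < cnt (fun φ : α → κ => ∀ a b, H.Adj a b → G.Adj (x (φ a)) (x (φ b))) := by
        unfold cnt
        norm_cast
        refine Finset.card_pos.2 ⟨fun a => f2 (f1 a), ?_⟩
        simp only [Finset.mem_filter, Finset.mem_univ, true_and]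
        intro a b hab
        exact f2.map_adj (f1.map_adj hab)
      unfold cnt at this ⊢
      norm_cast at this ⊢)
  obtain ⟨T, hT1, hT2⟩ := hN V (by omega) _ (le_trans (by
    have hne : (0 : ℝ) < Fintype.card (α → κ) := by
      have : 0 < Fintype.card (α → κ) := Fintype.card_pos_iff.2 ⟨φ⟩
      exact_mod_cast this
    rw [mul_one, div_mul_eq_mul_div]
    gcongr
    linarith) (hφ.trans (le_of_eq (by congr!))))
  let e := Fintype.equivFin α
  refine ⟨⟨fun a => T (φ a) (e a), ?_⟩, ?_⟩
  · intro a b hab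
    have hne : φ a ≠ φ b := by
      intro h
      have := hT2 (fun _ => e a) a b hab
      rw [h] at this
      exact absurd this (SimpleGraph.irrefl _)
    have := hT2 (fun i => if i = φ a then e a else e b) a b hab
    simpa [hne.symm] using this
  · intro a b hab
    exact e.injective (hT1 _ _ _ _ hab).2

open Classical in
lemma cnt_or {Y : Type*} [Fintype Y] (P Q : Y → Prop) :
    cnt (fun y => P y ∨ Q y) ≤ cnt P + cnt Q := by
  simp only [cnt_eq_sum]
  rw [← Finset.sum_add_distrib]
  apply Finset.sum_le_sum
  intro y _
  by_cases hp : P y <;> by_cases hq : Q y <;> simp [hp, hq]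

open Classical in
lemma cnt_exists {Y Z : Type*} [Fintype Y] [Fintype Z] (P : Z → Y → Prop) :
    cnt (fun y => ∃ z, P z y) ≤ ∑ z, cnt (P z) := by
  simp only [cnt_eq_sum]
  rw [Finset.sum_comm]
  apply Finset.sum_le_sum
  intro y _
  split_ifs with h
  · obtain ⟨z, hz⟩ := h
    have := Finset.single_le_sum (f := fun z => if P z y then (1 : ℝ) else 0)
      (fun i _ => by positivity) (Finset.mem_univ z)
    simpa [hz] using this
  · positivity

open Classical in
lemma cnt_pi {I Z : Type*} [Fintype I] [DecidableEq I] [Fintype Z] (S : I → Z → Prop) :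
    cnt (fun e : I → Z => ∀ i, S i (e i)) = ∏ i, cnt (S i) := by
  unfold cnt
  rw [← Nat.cast_prod, ← Fintype.card_piFinset]
  congr 2
  ext e
  simp

open Classical in
lemma cnt_fst {Y Z : Type*} [Fintype Y] [Fintype Z] (P : Y → Prop) :
    cnt (fun p : Y × Z => P p.1) = cnt P * Fintype.card Z := by
  simp only [cnt_eq_sum]
  rw [Fintype.sum_prod_type, Finset.sum_mul]
  apply Finset.sum_congr rfl
  intro y _
  split_ifs <;> simp

open Classical in
lemma cnt_snd {Y Z : Type*} [Fintype Y] [Fintype Z] (P : Z → Prop) :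
    cnt (fun p : Y × Z => P p.2) = cnt P * Fintype.card Y := by
  simp only [cnt_eq_sum]
  rw [Fintype.sum_prod_type_right, Finset.sum_mul]
  apply Finset.sum_congr rfl
  intro y _
  split_ifs <;> simp

/-- `G` is close to being bipartite -/
def CloseBip {V : Type} [Fintype V] (G : SimpleGraph V) (ε : ℝ) : Prop :=
  ∃ G' : SimpleGraph V, G' ≤ G ∧
    ((G.edgeSet \ G'.edgeSet).ncard : ℝ) ≤ ε * (Fintype.card V : ℝ) ^ 2 ∧ G'.Colorable 2

open Classical in
lemma close_of_coloring {V : Type} [Fintype V] (G : SimpleGraph V) (ε : ℝ) (κ : V → Bool)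
    (h : cnt (fun p : V × V => G.Adj p.1 p.2 ∧ κ p.1 = κ p.2) ≤ ε * (Fintype.card V : ℝ) ^ 2) :
    CloseBip G ε := by
  refine ⟨⟨fun u v => G.Adj u v ∧ κ u ≠ κ v, ⟨fun u v h => ⟨h.1.symm, h.2.symm⟩⟩,
    ⟨fun u h => h.2 rfl⟩⟩, fun u v h => h.1, ?_, ?_⟩
  · refine le_trans ?_ h
    have hc : cnt (fun p : V × V => G.Adj p.1 p.2 ∧ κ p.1 = κ p.2) =
        (({p | G.Adj p.1 p.2 ∧ κ p.1 = κ p.2} : Set (V × V)).ncard : ℝ) := by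
      unfold cnt
      rw [← Set.ncard_coe_finset]
      congr 2
      ext p
      simp
    rw [hc]
    refine Nat.cast_le.2 ?_
    refine le_trans (Set.ncard_le_ncard (t := (fun p : V × V => s(p.1, p.2)) ''
      {p | G.Adj p.1 p.2 ∧ κ p.1 = κ p.2})
      ?_ (Set.toFinite _)) (Set.ncard_image_le (Set.toFinite _))
    intro e he
    induction e using Sym2.ind with
    | _ u v =>
      simp only [Set.mem_sdiff, SimpleGraph.mem_edgeSet] at he
      refine ⟨(u, v), ⟨he.1, ?_⟩, rfl⟩
      by_contra hne
      exact he.2 ⟨he.1, hne⟩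
  · refine SimpleGraph.Coloring.colorable (α := Bool) (SimpleGraph.Coloring.mk κ ?_)
    intro u v h
    exact h.2

open Classical in
lemma good_many {V : Type} [Fintype V] [Nonempty V] (G : SimpleGraph V) (c δ : ℝ) (p : ℕ)
    (hδ : 0 < δ) (hp : (1 - c) ^ p ≤ δ / 2)
    (hdeg : ∀ v, c * Fintype.card V ≤ cnt (G.Adj v)) :
    (1 / 2) * (Fintype.card V : ℝ) ^ p ≤
      cnt (fun U : Fin p → V => cnt (fun u => ∀ i, ¬ G.Adj u (U i)) ≤ δ * Fintype.card V) := by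
  set n : ℝ := ((Fintype.card V : ℕ) : ℝ) with hn
  have hn0 : 0 < n := by
    rw [hn]; exact_mod_cast Fintype.card_pos
  have h1 : ∑ U : Fin p → V, cnt (fun u => ∀ i, ¬ G.Adj u (U i)) ≤ n * ((δ / 2) * n ^ p) := by
    rw [sum_cnt_comm (fun (U : Fin p → V) (u : V) => ∀ i, ¬ G.Adj u (U i))]
    have : n * ((δ / 2) * n ^ p) = ∑ u : V, ((δ / 2) * n ^ p) := by simp [hn]
    rw [this]
    apply Finset.sum_le_sum
    intro u _
    rw [cnt_pi (fun (_ : Fin p) v => ¬ G.Adj u v)]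
    simp only [Finset.prod_const, Finset.card_univ, Fintype.card_fin]
    have h2 : cnt (fun v => ¬ G.Adj u v) ≤ (1 - c) * n := by
      have := cnt_not (G.Adj u)
      have := hdeg u
      linarith
    calc (cnt fun v => ¬ G.Adj u v) ^ p ≤ ((1 - c) * n) ^ p :=
          pow_le_pow_left₀ (cnt_nonneg _) h2 p
      _ = (1 - c) ^ p * n ^ p := mul_pow _ _ _
      _ ≤ _ := by gcongr
  have h2 := sum_ge_cnt_mul (fun U : Fin p → V =>
    ¬ (cnt (fun u => ∀ i, ¬ G.Adj u (U i)) ≤ δ * n)) (fun U => cnt (fun u => ∀ i, ¬ G.Adj u (U i)))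
    (δ * n) (fun U => cnt_nonneg _) (fun U hU => (not_le.1 hU).le)
  have h3 := cnt_not (fun U : Fin p → V => (cnt (fun u => ∀ i, ¬ G.Adj u (U i)) ≤ δ * n))
  have h4 : (Fintype.card (Fin p → V) : ℝ) = n ^ p := by simp [hn]
  rw [h4] at h3
  have h5 : cnt (fun U : Fin p → V => ¬ (cnt (fun u => ∀ i, ¬ G.Adj u (U i)) ≤ δ * n)) * (δ * n) ≤
    (1 / 2 * n ^ p) * (δ * n) := (h2.trans h1).trans (le_of_eq (by ring))
  have h6 := le_of_mul_le_mul_right h5 (by positivity)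
  linarith

/-- the sample vertices -/
abbrev Idx (p : ℕ) : Type := Fin p ⊕ ((Fin p × Fin p) ⊕ (Fin p × Fin p))

def smp {V : Type} {p : ℕ} (U : Fin p → V) (e : Fin p × Fin p → V × V) : Idx p → V :=
  Sum.elim U (Sum.elim (fun i => (e i).1) (fun i => (e i).2))

open Classical in
lemma sample_nonbip {V : Type} [Fintype V] [Nonempty V] (G : SimpleGraph V) (ε ε' : ℝ) (q : ℕ)
    (hε' : ε' ≤ 1) (h0 : 0 < ε') (hε'2 : ((q : ℝ) + 1) ^ 2 * ε' ≤ ε / 2)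
    (hfar : ¬ CloseBip G ε) (U : Fin (q + 1) → V)
    (hU : cnt (fun u => ∀ i, ¬ G.Adj u (U i)) ≤ ε / 4 * Fintype.card V) :
    (ε' * (Fintype.card V : ℝ) ^ 2) ^ ((q + 1) * (q + 1)) ≤
      cnt (fun e : Fin (q + 1) × Fin (q + 1) → V × V => ¬ (G.comap (smp U e)).Colorable 2) := by
  set n : ℝ := ((Fintype.card V : ℕ) : ℝ) with hn
  have hn0 : 0 < n := by
    rw [hn]; exact_mod_cast Fintype.card_pos
  have hf : ∃ f : V → Fin (q + 1), ∀ u, (∃ i, G.Adj u (U i)) → G.Adj u (U (f u)) := by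
    refine ⟨fun u => if h : ∃ i, G.Adj u (U i) then h.choose else 0, fun u hu => ?_⟩
    simp only [hu, dite_true]
    exact hu.choose_spec
  obtain ⟨f, hf⟩ := hf
  let E : Fin (q + 1) × Fin (q + 1) → V × V → Prop := fun i a =>
    (∃ j, G.Adj a.1 (U j)) ∧ (∃ j, G.Adj a.2 (U j)) ∧ f a.1 = i.1 ∧ f a.2 = i.2 ∧ G.Adj a.1 a.2
  let D : Fin (q + 1) × Fin (q + 1) → Prop := fun i => ε' * n ^ 2 ≤ cnt (E i)
  have h1 : (ε' * n ^ 2) ^ ((q + 1) * (q + 1)) ≤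
      cnt (fun e : Fin (q + 1) × Fin (q + 1) → V × V => ∀ i, (D i → E i (e i))) := by
    rw [cnt_pi (fun i a => D i → E i a)]
    have : (ε' * n ^ 2) ^ ((q + 1) * (q + 1)) =
      ∏ i : Fin (q + 1) × Fin (q + 1), (ε' * n ^ 2) := by simp
    rw [this]
    apply Finset.prod_le_prod
    · intro i _; positivity
    · intro i _
      by_cases hD : D i
      · have : cnt (fun a : V × V => D i → E i a) = cnt (E i) := by
          congr 1
          funext a
          simp only [hD, true_imp_iff]
        rw [this]
        exact hD
      · have : cnt (fun a : V × V => D i → E i a) = n ^ 2 := by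
          unfold cnt
          simp [hD, hn, pow_two]
        rw [this]
        nlinarith [sq_nonneg n]
  refine h1.trans (cnt_mono ?_)
  intro e he hcol
  have C : (G.comap (smp U e)).Coloring Bool := hcol.toColoring (by simp)
  apply hfar
  let κ : Fin (q + 1) → Bool := fun i => C (Sum.inl i)
  have hκ : ∀ i, D i → κ i.1 ≠ κ i.2 := by
    intro i hi
    obtain ⟨d1, d2, f1, f2, ha⟩ := he i hi
    have a1 := hf _ d1
    have a2 := hf _ d2
    rw [f1] at a1
    rw [f2] at a2
    have v1 : C (Sum.inl i.1) ≠ C (Sum.inr (Sum.inl i)) := C.valid (by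
      simpa [smp] using a1.symm)
    have v2 : C (Sum.inr (Sum.inl i)) ≠ C (Sum.inr (Sum.inr i)) := C.valid (by
      simpa [smp] using ha)
    have v3 : C (Sum.inr (Sum.inr i)) ≠ C (Sum.inl i.2) := C.valid (by
      simpa [smp] using a2)
    simp only [κ]
    revert v1 v2 v3
    generalize C (Sum.inl i.1) = x
    generalize C (Sum.inr (Sum.inl i)) = y
    generalize C (Sum.inr (Sum.inr i)) = z
    generalize C (Sum.inl i.2) = w
    revert x y z w
    decide
  refine close_of_coloring G ε (fun u => κ (f u)) ?_
  have b1 : cnt (fun a : V × V => G.Adj a.1 a.2 ∧ κ (f a.1) = κ (f a.2)) ≤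
      cnt (fun a : V × V => (∀ i, ¬ G.Adj a.1 (U i)) ∨ ((∀ i, ¬ G.Adj a.2 (U i)) ∨
        ∃ i, ¬ D i ∧ E i a)) := by
    apply cnt_mono
    rintro a ⟨ha, hk⟩
    by_cases d1 : ∃ j, G.Adj a.1 (U j)
    · by_cases d2 : ∃ j, G.Adj a.2 (U j)
      · right; right
        exact ⟨(f a.1, f a.2), fun hD => hκ _ hD hk, d1, d2, rfl, rfl, ha⟩
      · right; left
        simpa using d2
    · left
      simpa using d1
  have b2 := cnt_or (fun a : V × V => (∀ i, ¬ G.Adj a.1 (U i))) (fun a : V × V =>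
    ((∀ i, ¬ G.Adj a.2 (U i)) ∨ ∃ i, ¬ D i ∧ E i a))
  have b3 := cnt_or (fun a : V × V => (∀ i, ¬ G.Adj a.2 (U i))) (fun a : V × V =>
    (∃ i, ¬ D i ∧ E i a))
  have b4 := cnt_exists (fun i (a : V × V) => ¬ D i ∧ E i a)
  have b5 : ∑ i, cnt (fun (a : V × V) => ¬ D i ∧ E i a) ≤ ((q : ℝ) + 1) ^ 2 * (ε' * n ^ 2) := by
    have : ((q : ℝ) + 1) ^ 2 * (ε' * n ^ 2) =
      ∑ i : Fin (q + 1) × Fin (q + 1), (ε' * n ^ 2) := by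
      simp only [Finset.sum_const, Finset.card_univ, Fintype.card_prod, Fintype.card_fin,
        nsmul_eq_mul]
      push_cast
      ring
    rw [this]
    apply Finset.sum_le_sum
    intro i _
    by_cases hD : D i
    · have : cnt (fun (a : V × V) => ¬ D i ∧ E i a) = 0 := by
        unfold cnt
        simp [hD]
      rw [this]; positivity
    · exact (cnt_mono (fun a h => h.2)).trans (not_le.1 hD).le
  have b6 := cnt_fst (Z := V) (fun u => ∀ i, ¬ G.Adj u (U i))
  have b7 := cnt_snd (Y := V) (fun u => ∀ i, ¬ G.Adj u (U i))
  rw [b6] at b2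
  rw [b7] at b3
  rw [← hn] at b2 b3 ⊢
  have b8 : cnt (fun u => ∀ i, ¬ G.Adj u (U i)) * n ≤ ε / 4 * n * n := by gcongr
  have b9 : ((q : ℝ) + 1) ^ 2 * (ε' * n ^ 2) ≤ ε / 2 * n ^ 2 := by
    rw [← mul_assoc]; gcongr
  nlinarith

lemma oddW_bound (ι : Type) [Finite ι] : ∃ l : ℕ, ∀ F : SimpleGraph ι, ¬ F.Colorable 2 →
    OddW F l := by
  have : ∀ F : SimpleGraph ι, ∃ l, ¬ F.Colorable 2 → OddW F l := by
    intro F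
    by_cases h : F.Colorable 2
    · exact ⟨0, fun h' => absurd h h'⟩
    · rw [two_colorable_iff_forall_loop_even] at h
      push Not at h
      obtain ⟨u, w, hw⟩ := h
      exact ⟨w.length, fun _ => ⟨u, w, by simpa using hw, le_rfl⟩⟩
  choose l hl using this
  obtain ⟨M, hM⟩ := Set.Finite.bddAbove (Set.finite_range l)
  exact ⟨M, fun F hF => (hl F hF).mono (hM ⟨F, rfl⟩)⟩

open Classical in
lemma initial (c ε : ℝ) (hc0 : 0 < c) (hc1 : c ≤ 1) (hε : 0 < ε) :
    ∃ (ι : Type) (_ : Fintype ι) (η : ℝ) (l : ℕ), 0 < η ∧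
    ∀ (V : Type) [Fintype V] [Nonempty V] (G : SimpleGraph V),
      (∀ v, c * Fintype.card V ≤ cnt (G.Adj v)) → ¬ CloseBip G ε → DenseOdd G ι η l := by
  obtain ⟨q, hq⟩ := exists_pow_lt_of_lt_one (show 0 < ε / 4 / 2 by positivity)
    (show 1 - c < 1 by linarith)
  have hq' : (1 - c) ^ (q + 1) ≤ ε / 4 / 2 := by
    rw [pow_succ]
    have : 0 ≤ (1 - c) ^ q := pow_nonneg (by linarith) _
    nlinarith
  obtain ⟨l, hl⟩ := oddW_bound (Idx (q + 1))
  set ε' : ℝ := min 1 (ε / 2 / ((q : ℝ) + 1) ^ 2) with hε'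
  have he0 : 0 < ε' := lt_min one_pos (by positivity)
  refine ⟨Idx (q + 1), inferInstance, 1 / 2 * ε' ^ ((q + 1) * (q + 1)), l, by positivity,
    fun V _ _ G hdeg hfar => ?_⟩
  have h1 := good_many G c (ε / 4) (q + 1) (by positivity) hq' hdeg
  have h2 := prod_lower _ _ _ (sample_nonbip G ε ε' q (min_le_left _ _) he0 (by
    have : ε' ≤ ε / 2 / ((q : ℝ) + 1) ^ 2 := min_le_right _ _
    rw [le_div_iff₀ (by positivity)] at this
    linarith) hfar)
  have h3 : cnt (fun a : (Fin (q + 1) → V) × (Fin (q + 1) × Fin (q + 1) → V × V) =>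
      ¬ (G.comap (smp a.1 a.2)).Colorable 2) ≤
      cnt (fun x : Idx (q + 1) → V => OddW (G.comap x) l) := by
    refine cnt_inj (fun a => smp a.1 a.2) ?_ (fun a ha => hl _ ha)
    rintro ⟨U, e⟩ ⟨U', e'⟩ h
    refine Prod.ext ?_ ?_
    · funext i
      exact congrFun h (Sum.inl i)
    · funext i
      exact Prod.ext (congrFun h (Sum.inr (Sum.inl i))) (congrFun h (Sum.inr (Sum.inr i)))
  unfold DenseOdd
  refine le_trans ?_ ((h2.trans h3).trans (le_of_eq (by congr!)))
  have hcard : Fintype.card (Idx (q + 1)) = (q + 1) + 2 * ((q + 1) * (q + 1)) := by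
    simp [Idx]; ring
  rw [hcard, pow_add, pow_mul]
  calc _ = (1 / 2 * (Fintype.card V : ℝ) ^ (q + 1)) *
        (ε' * (Fintype.card V : ℝ) ^ 2) ^ ((q + 1) * (q + 1)) := by
        rw [mul_pow]; ring
    _ ≤ _ := by gcongr

lemma upper {α : Type*} [Fintype α] (H : SimpleGraph α) (g : ℕ) (hg : 2 ≤ g)
    (hmin : ∀ g' : ℕ, 0 < g' → g' < g → Nonempty (H →g cycleGraph (2 * g' + 1)))
    (c : ℝ) (hc : 2 / (2 * (g : ℝ) + 1) < c) (ε : ℝ) (hε : 0 < ε) :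
    ∃ N : ℕ, ∀ n : ℕ, N ≤ n →
    ∀ G : SimpleGraph (Fin n), ¬ Copies H G →
      (∀ v, c * n ≤ ((G.neighborSet v).ncard : ℝ)) →
      ∃ G' : SimpleGraph (Fin n), G' ≤ G ∧
        ((G.edgeSet \ G'.edgeSet).ncard : ℝ) ≤ ε * n ^ 2 ∧ G'.Colorable 2 := by
  classical
  have hgr : (2 : ℝ) ≤ g := by exact_mod_cast hg
  have hb1 : 2 / (2 * (g : ℝ) + 1) < 1 := by
    rw [div_lt_one (by positivity)]; linarith
  have hb0 : 0 < 2 / (2 * (g : ℝ) + 1) := by positivity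
  set c' := min c 1 with hc'
  have hcc : 2 / (2 * (g : ℝ) + 1) < c' := lt_min hc hb1
  have hc1 : c' ≤ 1 := min_le_right _ _
  obtain ⟨ι, _, η, l, hη, h1⟩ := initial c' ε (hb0.trans hcc) hc1 hε
  obtain ⟨κ, _, η', hη', h2⟩ := descent_iter c' g hg hc1 hcc l ι η hη
  obtain ⟨N, h3⟩ := final_embed H g hmin κ η' hη'
  refine ⟨N + 1, fun n hn G hH hdeg => ?_⟩
  have : Nonempty (Fin n) := ⟨⟨0, by omega⟩⟩
  have hd : ∀ v, c' * Fintype.card (Fin n) ≤ cnt (G.Adj v) := by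
    intro v
    have e : cnt (G.Adj v) = ((G.neighborSet v).ncard : ℝ) := by
      unfold cnt
      rw [← Set.ncard_coe_finset]
      congr 2
      ext w
      simp
    rw [e, Fintype.card_fin]
    refine le_trans ?_ (hdeg v)
    gcongr
    exact min_le_left _ _
  by_contra hcon
  refine hH (h3 (Fin n) G (by simp; omega) (h2 (Fin n) G hd (h1 (Fin n) G hd ?_)))
  simpa [CloseBip] using hcon

lemma majority {s : ℕ} (χ : Fin s → Bool) :
    ∃ b, (s : ℝ) / 2 ≤ ((Finset.univ.filter (fun j => χ j = b)).card : ℝ) := by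
  by_contra! h
  have h1 := h true
  have h2 := h false
  have h3 : (Finset.univ.filter (fun j => χ j = true)).card +
      (Finset.univ.filter (fun j => χ j = false)).card = s := by
    have := Finset.card_filter_add_card_filter_not (s := Finset.univ) (fun j => χ j = true)
    simpa using this
  have h4 : ((Finset.univ.filter (fun j => χ j = true)).card : ℝ) +
      ((Finset.univ.filter (fun j => χ j = false)).card : ℝ) = s := by exact_mod_cast h3
  linarith

/-- the balanced blow-up of an odd cycle -/
def blow (M s : ℕ) : SimpleGraph (Fin (M * s)) :=
  (cycleGraph M).comap (fun v => (finProdFinEquiv.symm v).1)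

lemma blow_free {α : Type*} (H : SimpleGraph α) (M s : ℕ)
    (hno : IsEmpty (H →g cycleGraph M)) : ¬ Copies H (blow M s) := by
  rintro ⟨f, _⟩
  exact hno.false ⟨fun a => (finProdFinEquiv.symm (f a)).1, fun h => f.map_adj h⟩

lemma blow_deg (k s : ℕ) (v : Fin ((k + 3) * s)) :
    ((blow (k + 3) s).neighborSet v).ncard = 2 * s := by
  have h : (blow (k + 3) s).neighborSet v = finProdFinEquiv ''
      (((cycleGraph (k + 3)).neighborSet (finProdFinEquiv.symm v).1) ×ˢ
        (Set.univ : Set (Fin s))) := by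
    ext w
    constructor
    · intro hw
      exact ⟨finProdFinEquiv.symm w, ⟨hw, trivial⟩, finProdFinEquiv.apply_symm_apply w⟩
    · rintro ⟨⟨i, j⟩, ⟨hi, _⟩, rfl⟩
      simp only [SimpleGraph.mem_neighborSet] at hi
      simp only [SimpleGraph.mem_neighborSet, blow, SimpleGraph.comap_adj,
        Equiv.symm_apply_apply]
      exact hi
  rw [h, Set.ncard_image_of_injective _ finProdFinEquiv.injective, Set.ncard_prod,
    Set.ncard_univ, Nat.card_fin]
  congr 1
  have := cycleGraph_degree_three_le (v := (finProdFinEquiv.symm v).1)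
  rw [← SimpleGraph.card_neighborSet_eq_degree] at this
  rw [← this, Set.ncard_eq_toFinset_card', Set.toFinset_card]

lemma blow_far (M s : ℕ) (hM : Odd M) (hM2 : 2 ≤ M) (G' : SimpleGraph (Fin (M * s)))
    (hcol : G'.Colorable 2) :
    (s : ℝ) / 2 * (s / 2) ≤ (((blow M s).edgeSet \ G'.edgeSet).ncard : ℝ) := by
  classical
  have C : G'.Coloring Bool := hcol.toColoring (by simp)
  have hmaj := fun i : Fin M => majority (fun j : Fin s => C (finProdFinEquiv (i, j)))
  choose κ hκ using hmaj
  have hex : ∃ i i', (cycleGraph M).Adj i i' ∧ κ i = κ i' := by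
    by_contra! hcon
    have : (cycleGraph M).Colorable 2 :=
      SimpleGraph.Coloring.colorable (α := Bool)
        (SimpleGraph.Coloring.mk κ (fun {u v} h => hcon u v h))
    have h2 := this.chromaticNumber_le
    rw [chromaticNumber_cycleGraph_of_odd M hM2 hM] at h2
    exact absurd h2 (by decide)
  obtain ⟨i, i', hadj, hii⟩ := hex
  refine (mul_le_mul (hκ i) (hκ i') (by positivity) (by positivity)).trans ?_
  rw [← Nat.cast_mul, ← Finset.card_product, ← Set.ncard_coe_finset]
  refine Nat.cast_le.2 ?_
  refine Set.ncard_le_ncard_of_injOn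
    (fun p : Fin s × Fin s => s(finProdFinEquiv (i, p.1), finProdFinEquiv (i', p.2))) ?_ ?_
    (Set.toFinite _)
  · rintro ⟨j, j'⟩ hj
    simp only [Finset.coe_product, Set.mem_prod, Finset.mem_coe, Finset.mem_filter,
      Finset.mem_univ, true_and] at hj
    refine ⟨?_, ?_⟩
    · simp only [SimpleGraph.mem_edgeSet, blow, SimpleGraph.comap_adj,
        Equiv.symm_apply_apply]
      exact hadj
    · intro hE
      rw [SimpleGraph.mem_edgeSet] at hE
      apply C.valid hE
      rw [hj.1, hj.2, hii]
  · rintro ⟨j, j'⟩ _ ⟨l, l'⟩ _ h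
    simp only [Sym2.eq_iff, EmbeddingLike.apply_eq_iff_eq, Prod.mk.injEq, true_and] at h
    rcases h with h | h
    · exact Prod.ext h.1 h.2
    · exact absurd h.1.1 hadj.ne

/-- For a 3-chromatic graph `H`, if `g` is the smallest positive integer such that `H` is
not homomorphic to `C_{2g+1}`, then `δ*_χ(H, 2) = 2 / (2g + 1)`. -/
theorem statement6 {α : Type*} [Fintype α] (H : SimpleGraph α)
    (hchi : H.chromaticNumber = 3) (g : ℕ) (hg : 0 < g)
    (hno : IsEmpty (H →g cycleGraph (2 * g + 1)))
    (hmin : ∀ g' : ℕ, 0 < g' → g' < g → Nonempty (H →g cycleGraph (2 * g' + 1))) :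
    deltaStar H 2 = 2 / (2 * (g : ℝ) + 1) := by
  have hg2 : 2 ≤ g := by
    by_contra hlt
    have : g = 1 := by omega
    subst this
    have hcol : H.Colorable 3 := by
      rw [← chromaticNumber_le_iff_colorable, hchi]
      norm_num
    have e : cycleGraph (2 * 1 + 1) = (⊤ : SimpleGraph (Fin 3)) := cycleGraph_three_eq_top
    rw [e] at hno
    exact hno.elim hcol.some
  have hup := upper H g hg2 hmin
  have hb0 : 0 < 2 / (2 * (g : ℝ) + 1) := by positivity
  have hmem : ∀ δ : ℝ, 0 < δ → (2 / (2 * (g : ℝ) + 1) + δ) ∈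
    {c : ℝ | 0 ≤ c ∧ ∀ ε : ℝ, 0 < ε → ∃ N : ℕ, ∀ n : ℕ, N ≤ n →
    ∀ G : SimpleGraph (Fin n), ¬ Copies H G →
      (∀ v, c * n ≤ ((G.neighborSet v).ncard : ℝ)) →
      ∃ G' : SimpleGraph (Fin n), G' ≤ G ∧
        ((G.edgeSet \ G'.edgeSet).ncard : ℝ) ≤ ε * n ^ 2 ∧ G'.Colorable 2} :=
    fun δ hδ => ⟨by positivity, fun ε hε => hup _ (by linarith) ε hε⟩
  unfold deltaStar
  apply le_antisymm
  · apply le_of_forall_pos_le_add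
    intro δ hδ
    exact csInf_le ⟨0, fun c hc => hc.1⟩ (hmem δ hδ)
  · refine le_csInf ⟨_, hmem 1 one_pos⟩ ?_
    rintro c ⟨hc0, hc⟩
    by_contra! hlt
    have hM0 : (0 : ℝ) < 2 * g + 1 := by positivity
    obtain ⟨N, hN⟩ := hc (1 / (8 * (2 * (g : ℝ) + 1) ^ 2)) (by positivity)
    obtain ⟨G', _, h2, h3⟩ := hN ((2 * g + 1) * (N + 1)) (by nlinarith) (blow (2 * g + 1) (N + 1))
      (blow_free H _ _ hno) (by
        intro v
        obtain ⟨k, rfl⟩ : ∃ k, g = k + 1 := ⟨g - 1, by omega⟩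
        have hd := blow_deg (2 * k) (N + 1) v
        have hd' : (((blow (2 * (k + 1) + 1) (N + 1)).neighborSet v).ncard : ℝ) =
          2 * ((N : ℝ) + 1) := by
          have : ((blow (2 * (k + 1) + 1) (N + 1)).neighborSet v).ncard = 2 * (N + 1) := hd
          rw [this]
          push_cast
          ring
        rw [hd']
        rw [lt_div_iff₀ hM0] at hlt
        push_cast at hlt ⊢
        have hN0 : (0 : ℝ) ≤ N + 1 := by positivity
        nlinarith)
    have h4 := (blow_far (2 * g + 1) (N + 1) ⟨g, rfl⟩ (by omega) G' h3).trans h2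
    push_cast at h4
    have h5 : 1 / (8 * (2 * (g : ℝ) + 1) ^ 2) * ((2 * g + 1) * ((N : ℝ) + 1)) ^ 2 =
      ((N : ℝ) + 1) ^ 2 / 8 := by
      field_simp
    rw [h5] at h4
    have : (0 : ℝ) < ((N : ℝ) + 1) ^ 2 := by positivity
    nlinarith
end

section
/- For every simple graph H and every positive integer k, δ*_χ(H, k) = δ_χ(H-hom, k). -/
open SimpleGraph

/-- `deltaHom H k` is the infimum of all `c ≥ 0` such that every graph `G` with minimum
degree at least `c * |G|` to which `H` is not homomorphic is `k`-colourable. -/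
noncomputable def deltaHom {α : Type*} (H : SimpleGraph α) (k : ℕ) : ℝ :=
  sInf {c : ℝ | 0 ≤ c ∧ ∀ n : ℕ, ∀ G : SimpleGraph (Fin n),
    IsEmpty (H →g G) → (∀ v, c * n ≤ ((G.neighborSet v).ncard : ℝ)) → G.Colorable k}

/-- Greedy embedding lemma: a family of large sets, uniform and dense along the edges of `H`,
contains a copy of `H`. -/
theorem embed_aux {α V : Type*} [DecidableEq α] [DecidableEq V] [Nonempty V]
    (H : SimpleGraph α) (G : SimpleGraph V) [DecidableRel G.Adj]
    (A : α → Finset V) (d e : ℝ) (hd : 0 < d) (hd1 : d ≤ 1) (he : 0 < e)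
    (hU : ∀ x y, H.Adj x y → G.IsUniform e (A x) (A y))
    (hD : ∀ x y, H.Adj x y → d ≤ (G.edgeDensity (A x) (A y) : ℝ)) (S : Finset α) :
    ∀ (C : α → Finset V) (δ : ℝ), 0 < δ → δ ≤ 1 →
      (∀ x ∈ S, C x ⊆ A x) → (∀ x ∈ S, δ * (A x).card ≤ (C x).card) →
      ((S.card + 1) * e ≤ δ * (d / 4) ^ S.card) →
      (∀ x ∈ S, 1 ≤ δ * (d / 4) ^ S.card * (A x).card) →
      ∃ f : α → V, (∀ x ∈ S, f x ∈ C x) ∧ Set.InjOn f S ∧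
        ∀ x ∈ S, ∀ y ∈ S, H.Adj x y → G.Adj (f x) (f y) := by
  classical
  induction S using Finset.induction_on with
  | empty =>
    intro C δ hδ hδ1 _ _ h3 _
    obtain ⟨v⟩ := (inferInstance : Nonempty V)
    exact ⟨fun _ => v, by simp, by simp, by simp⟩
  | insert x S hx ih =>
    intro C δ hδ hδ1 hCA hC he2 hbig
    rw [Finset.card_insert_of_notMem hx] at he2 hbig
    push_cast at he2
    have hq : 0 < d / 4 := by positivity
    have hq1 : d / 4 ≤ 1 := by linarith
    have hpow1 : (d / 4) ^ (S.card + 1) ≤ d / 4 := by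
      rw [pow_succ]
      have := pow_le_one₀ (n := S.card) hq.le hq1
      nlinarith
    have hpow0 : 0 < (d / 4) ^ (S.card + 1) := by positivity
    have hδp : δ * (d / 4) ^ (S.card + 1) ≤ δ * (d / 4) := by gcongr
    have hδq : δ * (d / 4) ≤ d / 4 := by nlinarith
    have hδq' : δ * (d / 4) ≤ δ := by nlinarith
    have hSc : (0 : ℝ) ≤ S.card := by positivity
    have he3 : e ≤ δ * (d / 4) := by nlinarith
    have heδ : (S.card + 1) * e ≤ δ := by nlinarith
    have hApos : ∀ y ∈ insert x S, 0 < ((A y).card : ℝ) := by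
      intro y hy
      have := hbig y hy
      by_contra h
      have h0 : ((A y).card : ℝ) = 0 := le_antisymm (not_lt.1 h) (by positivity)
      rw [h0] at this
      norm_num at this
    have hx' := Finset.mem_insert_self x S
    -- bad sets
    let B : α → Finset V := fun y =>
      (C x).filter fun v => (((C y).filter fun w => G.Adj v w).card : ℝ) < (d - e) * (C y).card
    have hB : ∀ y ∈ S, H.Adj x y → ((B y).card : ℝ) < e * (A x).card := by
      intro y hy hxy
      by_contra hcon
      push Not at hcon
      have hy' : y ∈ insert x S := Finset.mem_insert_of_mem hy
      have hBpos : 0 < ((B y).card : ℝ) := lt_of_lt_of_le (mul_pos he (hApos x hx')) hcon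
      have hCy := hC y hy'
      have hCpos : 0 < ((C y).card : ℝ) := lt_of_lt_of_le (mul_pos hδ (hApos y hy')) hCy
      have h1 := hU x y hxy ((Finset.filter_subset _ _).trans (hCA x hx') : B y ⊆ A x)
        (hCA y hy') (by rw [mul_comm]; exact hcon)
        (by
          rw [mul_comm]
          refine le_trans ?_ hCy
          gcongr
          linarith)
      have h2 := hD x y hxy
      have h3 : d - e < (G.edgeDensity (B y) (C y) : ℝ) := by
        have := (abs_lt.1 h1).1
        linarith
      have h4 : ((G.interedges (B y) (C y)).card : ℝ) ≤ (B y).card * ((d - e) * (C y).card) := by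
        have : (G.interedges (B y) (C y)).card
            = ∑ v ∈ B y, ((C y).filter fun w => G.Adj v w).card := by
          rw [SimpleGraph.interedges, Rel.interedges, Finset.card_filter, Finset.sum_product]
          exact Finset.sum_congr rfl fun v _ => (Finset.card_filter _ _).symm
        rw [this]
        push_cast
        rw [← nsmul_eq_mul]
        apply Finset.sum_le_card_nsmul
        intro v hv
        exact (Finset.mem_filter.1 hv).2.le
      rw [SimpleGraph.edgeDensity_def] at h3
      push_cast at h3
      rw [lt_div_iff₀ (by positivity)] at h3
      nlinarith
    have hex : ∃ v ∈ C x, ∀ y ∈ S, H.Adj x y → v ∉ B y := by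
      by_contra hcon
      push Not at hcon
      have hsub : C x ⊆ (S.filter fun y => H.Adj x y).biUnion B := by
        intro v hv
        obtain ⟨y, hy, hxy, hvy⟩ := hcon v hv
        exact Finset.mem_biUnion.2 ⟨y, Finset.mem_filter.2 ⟨hy, hxy⟩, hvy⟩
      have h1 : ((C x).card : ℝ) ≤ S.card * (e * (A x).card) := by
        calc ((C x).card : ℝ) ≤ (((S.filter fun y => H.Adj x y).biUnion B).card : ℝ) := by
              exact_mod_cast Finset.card_le_card hsub
          _ ≤ ∑ y ∈ S.filter (fun y => H.Adj x y), ((B y).card : ℝ) := by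
              exact_mod_cast Finset.card_biUnion_le
          _ ≤ (S.filter fun y => H.Adj x y).card • (e * (A x).card : ℝ) := by
              apply Finset.sum_le_card_nsmul
              intro y hy
              obtain ⟨h1, h2⟩ := Finset.mem_filter.1 hy
              exact (hB y h1 h2).le
          _ ≤ S.card * (e * (A x).card) := by
              rw [nsmul_eq_mul]
              gcongr
              exact Finset.filter_subset _ _
      have h2 := hC x hx'
      have h3 := hApos x hx'
      have h4 : (S.card + 1) * e * (A x).card ≤ δ * (A x).card := by gcongr
      nlinarith [mul_pos he h3]
    obtain ⟨v, hv, hvB⟩ := hex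
    let C' : α → Finset V := fun y =>
      (if H.Adj x y then (C y).filter fun w => G.Adj v w else C y).erase v
    have hC'sub : ∀ y, C' y ⊆ C y := by
      intro y
      refine (Finset.erase_subset _ _).trans ?_
      split_ifs
      · exact Finset.filter_subset _ _
      · exact subset_rfl
    obtain ⟨f, hf1, hf2, hf3⟩ := ih C' (δ * (d / 4)) (by positivity) (by linarith)
      (fun y hy => (hC'sub y).trans (hCA y (Finset.mem_insert_of_mem hy)))
      (by
        intro y hy
        have hy' : y ∈ insert x S := Finset.mem_insert_of_mem hy
        have h1 : ((if H.Adj x y then (C y).filter fun w => G.Adj v w else C y).card : ℝ)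
            ≤ (C' y).card + 1 := by
          have := Finset.pred_card_le_card_erase
            (s := if H.Adj x y then (C y).filter fun w => G.Adj v w else C y) (a := v)
          have h : (if H.Adj x y then (C y).filter fun w => G.Adj v w else C y).card
            ≤ (C' y).card + 1 := by
              simp only [C']
              omega
          exact_mod_cast h
        have h2 : (d / 2) * (C y).card ≤
            ((if H.Adj x y then (C y).filter fun w => G.Adj v w else C y).card : ℝ) := by
          split_ifs with hxy
          · have := hvB y hy hxy
            simp only [B, Finset.mem_filter, not_and, not_lt] at this
            refine le_trans ?_ (this hv)
            gcongr
            linarith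
          · have : (0 : ℝ) ≤ (C y).card := by positivity
            nlinarith
        have h3 := hC y hy'
        have h4 := hbig y hy'
        have h5 := hApos y hy'
        have h6 : δ * (d / 4) ^ (S.card + 1) * (A y).card ≤ δ * (d / 4) * (A y).card := by
          gcongr
        have h7 : (d / 2) * (δ * (A y).card) ≤ (d / 2) * (C y).card := by gcongr
        nlinarith)
      (by
        have : δ * (d / 4) * (d / 4) ^ S.card = δ * (d / 4) ^ (S.card + 1) := by ring
        rw [this]
        nlinarith)
      (by
        intro y hy
        have : δ * (d / 4) * (d / 4) ^ S.card = δ * (d / 4) ^ (S.card + 1) := by ring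
        rw [this]
        exact hbig y (Finset.mem_insert_of_mem hy))
    have hne : ∀ y ∈ S, y ≠ x := fun y hy h => hx (h ▸ hy)
    have hfv : ∀ y ∈ S, f y ≠ v := fun y hy => Finset.ne_of_mem_erase (hf1 y hy)
    have hadj : ∀ y ∈ S, H.Adj x y → G.Adj v (f y) := by
      intro y hy hxy
      have := Finset.mem_of_mem_erase (hf1 y hy)
      rw [if_pos hxy] at this
      exact (Finset.mem_filter.1 this).2
    refine ⟨Function.update f x v, ?_, ?_, ?_⟩
    · intro y hy
      rcases Finset.mem_insert.1 hy with rfl | hy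
      · simpa using hv
      · rw [Function.update_of_ne (hne y hy)]
        exact hC'sub y (hf1 y hy)
    · intro y hy z hz hyz
      rcases Finset.mem_insert.1 (Finset.mem_coe.1 hy) with rfl | hy1 <;>
      rcases Finset.mem_insert.1 (Finset.mem_coe.1 hz) with rfl | hz1
      · rfl
      · rw [Function.update_self, Function.update_of_ne (hne z hz1)] at hyz
        exact absurd hyz.symm (hfv z hz1)
      · rw [Function.update_self, Function.update_of_ne (hne y hy1)] at hyz
        exact absurd hyz (hfv y hy1)
      · rw [Function.update_of_ne (hne z hz1), Function.update_of_ne (hne y hy1)] at hyz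
        exact hf2 hy1 hz1 hyz
    · intro y hy z hz hyz
      rcases Finset.mem_insert.1 hy with rfl | hy1 <;>
      rcases Finset.mem_insert.1 hz with rfl | hz1
      · exact absurd hyz (H.irrefl)
      · rw [Function.update_self, Function.update_of_ne (hne z hz1)]
        exact hadj z hz1 hyz
      · rw [Function.update_self, Function.update_of_ne (hne y hy1)]
        exact (hadj y hy1 hyz.symm).symm
      · rw [Function.update_of_ne (hne z hz1), Function.update_of_ne (hne y hy1)]
        exact hf3 y hy1 z hz1 hyz

/-- Removal lemma: an `H`-free graph can be made `H`-hom-free by deleting few edges. -/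
theorem hom_removal {α : Type*} [Fintype α] (H : SimpleGraph α) (ε : ℝ) (hε : 0 < ε) :
    ∃ N : ℕ, ∀ n : ℕ, N ≤ n → ∀ G : SimpleGraph (Fin n), ¬ Copies H G →
      ∃ G' : SimpleGraph (Fin n), G' ≤ G ∧ IsEmpty (H →g G') ∧
        (({p : Fin n × Fin n | G.Adj p.1 p.2 ∧ ¬ G'.Adj p.1 p.2}.ncard : ℕ) : ℝ) ≤ ε * n ^ 2 := by
  classical
  set h := Fintype.card α with hh
  set d : ℝ := min ε 1 / 16 with hd
  have hm : 0 < min ε 1 := lt_min hε one_pos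
  have hm1 : min ε 1 ≤ 1 := min_le_right _ _
  have hm2 : min ε 1 ≤ ε := min_le_left _ _
  have hd0 : 0 < d := by positivity
  have hd1 : d ≤ 1 := by linarith
  set e : ℝ := min ((d / 4) ^ h / (h + 1)) d with he
  have he0 : 0 < e := lt_min (by positivity) hd0
  have hed : e ≤ d := min_le_right _ _
  have heh : (h + 1) * e ≤ 1 * (d / 4) ^ h := by
    have : e ≤ (d / 4) ^ h / (h + 1) := min_le_left _ _
    rw [le_div_iff₀ (by positivity)] at this
    linarith
  set l : ℕ := ⌈4 / ε⌉₊ with hl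
  set M := SzemerediRegularity.bound e l with hM
  have hMpos : 0 < M := SzemerediRegularity.bound_pos _ _
  set L : ℕ := ⌈1 / (d / 4) ^ h⌉₊ with hL
  refine ⟨max (max l 1) (M * L), fun n hn G hG => ?_⟩
  have hn1 : l ≤ n := le_trans (le_max_left _ _) (le_trans (le_max_left _ _) hn)
  have hn2 : 1 ≤ n := le_trans (le_max_right _ _) (le_trans (le_max_left _ _) hn)
  have hn3 : M * L ≤ n := le_trans (le_max_right _ _) hn
  haveI : Nonempty (Fin n) := ⟨⟨0, hn2⟩⟩
  obtain ⟨P, hP1, hP2, hP3, hP4⟩ := szemeredi_regularity G he0 (l := l) (by simpa using hn1)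
  refine ⟨G.regularityReduced P e d, SimpleGraph.regularityReduced_le, ⟨fun f => hG ?_⟩, ?_⟩
  · -- embedding
    let A : α → Finset (Fin n) := fun x => P.part (f x)
    have hAmem : ∀ x, A x ∈ P.parts := fun x => P.part_mem.2 (Finset.mem_univ _)
    have hUD : ∀ x y, H.Adj x y → G.IsUniform e (A x) (A y) ∧
        d ≤ (G.edgeDensity (A x) (A y) : ℝ) := by
      intro x y hxy
      obtain ⟨-, U, hU, V, hV, hxU, hyV, -, h1, h2⟩ := f.map_rel hxy
      have e1 : A x = U := P.part_eq_of_mem hU hxU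
      have e2 : A y = V := P.part_eq_of_mem hV hyV
      rw [e1, e2]
      exact ⟨h1, h2⟩
    have hbig : ∀ x, 1 ≤ 1 * (d / 4) ^ h * (A x).card := by
      intro x
      have h1 := hP1.average_le_card_part (hAmem x)
      have h2 : L ≤ (A x).card := by
        refine le_trans ?_ h1
        have hp : 0 < P.parts.card := Finset.card_pos.2 ⟨_, hAmem x⟩
        rw [Nat.le_div_iff_mul_le hp]
        simp only [Finset.card_univ, Fintype.card_fin]
        calc L * P.parts.card ≤ L * M := Nat.mul_le_mul_left _ hP3
          _ = M * L := mul_comm _ _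
          _ ≤ n := hn3
      have h3 : 1 / (d / 4) ^ h ≤ ((A x).card : ℝ) :=
        (Nat.le_ceil _).trans (by exact_mod_cast h2)
      rw [div_le_iff₀ (by positivity)] at h3
      linarith
    obtain ⟨g, -, hg2, hg3⟩ := embed_aux H G A d e hd0 hd1 he0 (fun x y h => (hUD x y h).1)
      (fun x y h => (hUD x y h).2) Finset.univ A 1 one_pos le_rfl (fun _ _ => subset_rfl)
      (fun _ _ => by simp) (by rw [Finset.card_univ]; exact heh)
      (fun x _ => by rw [Finset.card_univ]; exact hbig x)
    refine ⟨⟨g, fun {a b} hab => hg3 a (Finset.mem_univ _) b (Finset.mem_univ _) hab⟩, ?_⟩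
    intro a b hab
    exact hg2 (by simp) (by simp) hab
  · let X := (P.nonUniforms G e).biUnion fun (U, V) ↦ U ×ˢ V
    let Y := P.parts.biUnion Finset.offDiag
    let Z := (P.sparsePairs G d).biUnion fun (U, V) ↦ G.interedges U V
    have hsub : {p : Fin n × Fin n | G.Adj p.1 p.2 ∧ ¬ (G.regularityReduced P e d).Adj p.1 p.2}
        ⊆ ((X ∪ Y ∪ Z : Finset _) : Set (Fin n × Fin n)) := by
      rintro ⟨x, y⟩ ⟨hxy, hn⟩
      simp only [SimpleGraph.regularityReduced_adj, not_and, not_exists, not_le] at hn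
      have hx := P.part_mem.2 (Finset.mem_univ x)
      have hy := P.part_mem.2 (Finset.mem_univ y)
      have hx' := P.mem_part (Finset.mem_univ x)
      have hy' := P.mem_part (Finset.mem_univ y)
      simp only [Finset.coe_union, Set.mem_union, Finset.mem_coe]
      by_cases hxy' : P.part x = P.part y
      · left; right
        exact Finset.mem_biUnion.2 ⟨P.part x, hx, Finset.mem_offDiag.2
          ⟨hx', hxy' ▸ hy', hxy.ne⟩⟩
      by_cases hu : G.IsUniform e (P.part x) (P.part y)
      · right
        exact Finset.mem_biUnion.2 ⟨(P.part x, P.part y), (P.mk_mem_sparsePairs G _ _ _).2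
          ⟨hx, hy, hxy', hn hxy _ hx _ hy hx' hy' hxy' hu⟩,
          Rel.mk_mem_interedges_iff.2 ⟨hx', hy', hxy⟩⟩
      · left; left
        exact Finset.mem_biUnion.2 ⟨(P.part x, P.part y), (P.mk_mem_nonUniforms G).2
          ⟨hx, hy, hxy', hu⟩, Finset.mk_mem_product hx' hy'⟩
    have h1 := Set.ncard_le_ncard hsub (Finset.finite_toSet _)
    rw [Set.ncard_coe_finset] at h1
    have h2 : ((X ∪ Y ∪ Z).card : ℝ) ≤ X.card + Y.card + Z.card := by
      have a := Finset.card_union_le (X ∪ Y) Z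
      have b := Finset.card_union_le X Y
      exact_mod_cast a.trans (by omega)
    have hX : (X.card : ℝ) < 4 * e * n ^ 2 := by
      simpa using hP1.sum_nonUniforms_lt Finset.univ_nonempty he0 hP4
    have hY : (Y.card : ℝ) ≤ ε / 2 * n ^ 2 := by
      simpa using hP1.card_biUnion_offDiag_le hε
        ((Nat.le_ceil _).trans (by exact_mod_cast hP2))
    have hZ : (Z.card : ℝ) ≤ 4 * d * n ^ 2 := by
      simpa using hP1.card_interedges_sparsePairs_le (G := G) (ε := d) hd0.le
    have h3 : (({p : Fin n × Fin n | G.Adj p.1 p.2 ∧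
        ¬ (G.regularityReduced P e d).Adj p.1 p.2}.ncard : ℕ) : ℝ) ≤ (X ∪ Y ∪ Z).card := by
      exact_mod_cast h1
    have hn0 : (0 : ℝ) ≤ (n : ℝ) ^ 2 := by positivity
    have h4 : (4 * e + ε / 2 + 4 * d) * (n : ℝ) ^ 2 ≤ ε * n ^ 2 := by
      gcongr
      linarith
    linarith

/-- Transfer of the defining property of `deltaHom` to arbitrary finite vertex types. -/
theorem hom_transfer {α : Type*} (H : SimpleGraph α) (k : ℕ) (c : ℝ)
    (hc : ∀ n : ℕ, ∀ G : SimpleGraph (Fin n),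
      IsEmpty (H →g G) → (∀ v, c * n ≤ ((G.neighborSet v).ncard : ℝ)) → G.Colorable k)
    {V : Type*} [Fintype V] (G : SimpleGraph V) (hG : IsEmpty (H →g G))
    (hdeg : ∀ v, c * Fintype.card V ≤ ((G.neighborSet v).ncard : ℝ)) : G.Colorable k := by
  let e := Fintype.equivFin V
  have h := hc (Fintype.card V) (G.comap e.symm)
    ⟨fun f => hG.false ((SimpleGraph.Hom.comap e.symm G).comp f)⟩ (by
      intro v
      have : (G.comap e.symm).neighborSet v = e '' (G.neighborSet (e.symm v)) := by
        ext w
        simp only [SimpleGraph.mem_neighborSet, SimpleGraph.comap_adj, Set.mem_image]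
        constructor
        · intro h
          exact ⟨e.symm w, h, by simp⟩
        · rintro ⟨u, hu, rfl⟩
          simpa using hu
      rw [this, Set.ncard_image_of_injective _ e.injective]
      exact hdeg _)
  obtain ⟨C⟩ := h
  exact ⟨SimpleGraph.Coloring.mk (fun v => C (e v)) (by
    intro v w hvw
    exact C.valid (by simpa using hvw))⟩

theorem dirOne {α : Type*} (H : SimpleGraph α) (k : ℕ) (hk : 0 < k) (c : ℝ)
    (hc : ∀ ε : ℝ, 0 < ε → ∃ N : ℕ, ∀ n : ℕ, N ≤ n →
      ∀ G : SimpleGraph (Fin n), ¬ Copies H G →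
        (∀ v, c * n ≤ ((G.neighborSet v).ncard : ℝ)) →
        ∃ G' : SimpleGraph (Fin n), G' ≤ G ∧
          ((G.edgeSet \ G'.edgeSet).ncard : ℝ) ≤ ε * n ^ 2 ∧ G'.Colorable k)
    (m : ℕ) (G : SimpleGraph (Fin m)) (hG : IsEmpty (H →g G))
    (hdeg : ∀ v, c * m ≤ ((G.neighborSet v).ncard : ℝ)) : G.Colorable k := by
  classical
  rcases Nat.eq_zero_or_pos m with rfl | hm
  · exact ⟨SimpleGraph.Coloring.mk (fun v => v.elim0) (fun {v} => v.elim0)⟩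
  obtain ⟨N, hN⟩ := hc (1 / (2 * k ^ 2 * m ^ 2)) (by positivity)
  set s := N + 1 with hs
  set t := k * s with ht
  let e : Fin m × Fin t ≃ Fin (m * t) := finProdFinEquiv
  let pr : Fin (m * t) → Fin m := fun x => (e.symm x).1
  have hNt : N ≤ m * t := by
    have h1 : s ≤ t := Nat.le_mul_of_pos_left _ hk
    have h2 : t ≤ m * t := Nat.le_mul_of_pos_left _ hm
    omega
  obtain ⟨G', hle, hlost, ⟨C⟩⟩ := hN (m * t) hNt (G.comap pr)
    (fun ⟨f, _⟩ => hG.false ((SimpleGraph.Hom.comap pr G).comp f)) (by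
      intro v
      have : (G.comap pr).neighborSet v = e '' (G.neighborSet (pr v) ×ˢ Set.univ) := by
        ext w
        simp only [SimpleGraph.mem_neighborSet, SimpleGraph.comap_adj, Set.mem_image,
          Set.mem_prod, Set.mem_univ, and_true]
        constructor
        · intro h
          exact ⟨e.symm w, h, by simp⟩
        · rintro ⟨u, hu, rfl⟩
          simpa [pr] using hu
      rw [this, Set.ncard_image_of_injective _ e.injective, Set.ncard_prod, Set.ncard_univ]
      simp only [Nat.card_eq_fintype_card, Fintype.card_fin]
      push_cast
      have := hdeg (pr v)
      have h0 : (0 : ℝ) ≤ t := by positivity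
      nlinarith)
  have hmaj : ∀ i : Fin m, ∃ y : Fin k,
      s ≤ (Finset.univ.filter fun a : Fin t => C (e (i, a)) = y).card := by
    intro i
    haveI : Nonempty (Fin k) := ⟨⟨0, hk⟩⟩
    exact Fintype.exists_le_card_fiber_of_mul_le_card (fun a : Fin t => C (e (i, a)))
      (by simp [ht])
  choose y hy using hmaj
  refine ⟨SimpleGraph.Coloring.mk y ?_⟩
  intro i j hij hyij
  let F : Fin m → Finset (Fin t) := fun i => Finset.univ.filter fun a : Fin t => C (e (i, a)) = y i
  let φ : Fin t × Fin t → Sym2 (Fin (m * t)) := fun p => s(e (i, p.1), e (j, p.2))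
  have hφ : Function.Injective φ := by
    rintro ⟨a, b⟩ ⟨a', b'⟩ h
    simp only [φ, Sym2.eq_iff, e.injective.eq_iff, Prod.mk.injEq] at h
    rcases h with h | h
    · exact Prod.ext h.1.2 h.2.2
    · exact absurd h.1.1 hij.ne
  have hsub : φ '' ((F i ×ˢ F j : Finset _) : Set (Fin t × Fin t)) ⊆
      (G.comap pr).edgeSet \ G'.edgeSet := by
    rintro _ ⟨⟨a, b⟩, hab, rfl⟩
    simp only [Finset.coe_product, Set.mem_prod, Finset.mem_coe, F, Finset.mem_filter,
      Finset.mem_univ, true_and] at hab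
    refine ⟨?_, fun h => ?_⟩
    · simpa [φ, pr] using hij
    · have h' : G'.Adj (e (i, a)) (e (j, b)) := h
      apply C.valid h'
      rw [hab.1, hab.2, hyij]
  have h1 := Set.ncard_le_ncard hsub (Set.toFinite _)
  rw [Set.ncard_image_of_injective _ hφ, Set.ncard_coe_finset, Finset.card_product] at h1
  have h2 : s * s ≤ ((G.comap pr).edgeSet \ G'.edgeSet).ncard :=
    le_trans (Nat.mul_le_mul (hy i) (hy j)) h1
  have h3 : ((s * s : ℕ) : ℝ) ≤ 1 / (2 * k ^ 2 * m ^ 2) * ((m * t : ℕ) : ℝ) ^ 2 :=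
    le_trans (by exact_mod_cast h2) hlost
  have hk' : (0 : ℝ) < k := by exact_mod_cast hk
  have hm' : (0 : ℝ) < m := by exact_mod_cast hm
  have hs' : (0 : ℝ) < s := by positivity
  have h4 : 1 / (2 * k ^ 2 * m ^ 2) * ((m * t : ℕ) : ℝ) ^ 2 = (s : ℝ) * s / 2 := by
    rw [ht]
    push_cast
    field_simp
  rw [h4] at h3
  push_cast at h3
  have := mul_pos hs' hs'
  linarith

theorem dirTwo {α : Type*} [Fintype α] (H : SimpleGraph α) (k : ℕ) (hk : 0 < k) (c : ℝ)
    (hc0 : 0 ≤ c)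
    (hc : ∀ n : ℕ, ∀ G : SimpleGraph (Fin n),
      IsEmpty (H →g G) → (∀ v, c * n ≤ ((G.neighborSet v).ncard : ℝ)) → G.Colorable k)
    (η : ℝ) (hη : 0 < η) (ε : ℝ) (hε : 0 < ε) :
    ∃ N : ℕ, ∀ n : ℕ, N ≤ n →
      ∀ G : SimpleGraph (Fin n), ¬ Copies H G →
        (∀ v, (c + η) * n ≤ ((G.neighborSet v).ncard : ℝ)) →
        ∃ G' : SimpleGraph (Fin n), G' ≤ G ∧
          ((G.edgeSet \ G'.edgeSet).ncard : ℝ) ≤ ε * n ^ 2 ∧ G'.Colorable k := by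
  classical
  set ρ : ℝ := min (η ^ 2 / 4) (min (ε / 2) (ε * η / 4)) with hρ
  have hρ0 : 0 < ρ := lt_min (by positivity) (lt_min (by positivity) (by positivity))
  have hρ1 : ρ ≤ η ^ 2 / 4 := min_le_left _ _
  have hρ2 : ρ ≤ ε / 2 := (min_le_right _ _).trans (min_le_left _ _)
  have hρ3 : ρ ≤ ε * η / 4 := (min_le_right _ _).trans (min_le_right _ _)
  obtain ⟨N, hN⟩ := hom_removal H ρ hρ0
  refine ⟨max N 1, fun n hn G hG hdeg => ?_⟩
  have hn1 : 0 < n := (le_max_right N 1).trans hn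
  have hnR : (0 : ℝ) < n := by exact_mod_cast hn1
  obtain ⟨G1, hle, hfree, hlost⟩ := hN n ((le_max_left _ _).trans hn) G hG
  set T := {p : Fin n × Fin n | G.Adj p.1 p.2 ∧ ¬ G1.Adj p.1 p.2} with hT
  let D : Fin n → Finset (Fin n) := fun v => Finset.univ.filter fun w => G.Adj v w ∧ ¬ G1.Adj v w
  have hTD : T.ncard = ∑ v, (D v).card := by
    have : T = ((Finset.univ.filter fun p : Fin n × Fin n =>
        G.Adj p.1 p.2 ∧ ¬ G1.Adj p.1 p.2 : Finset _) : Set (Fin n × Fin n)) := by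
      ext p; simp [hT]
    rw [this, Set.ncard_coe_finset, Finset.card_filter, ← Finset.univ_product_univ,
      Finset.sum_product]
    exact Finset.sum_congr rfl fun v _ => (Finset.card_filter _ _).symm
  let bad : Finset (Fin n) := Finset.univ.filter fun v => η / 2 * n < ((D v).card : ℝ)
  have hbad : (bad.card : ℝ) * (η / 2) ≤ ρ * n := by
    have h1 : bad.card • (η / 2 * n) ≤ ∑ v ∈ bad, ((D v).card : ℝ) :=
      Finset.card_nsmul_le_sum _ _ _ fun v hv => (Finset.mem_filter.1 hv).2.le
    have h2 : ∑ v ∈ bad, ((D v).card : ℝ) ≤ ∑ v, ((D v).card : ℝ) :=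
      Finset.sum_le_sum_of_subset_of_nonneg (Finset.subset_univ _) fun _ _ _ => by positivity
    have h3 : ∑ v, ((D v).card : ℝ) ≤ ρ * n ^ 2 := by
      have : ((T.ncard : ℕ) : ℝ) = ∑ v, ((D v).card : ℝ) := by rw [hTD]; push_cast; rfl
      rw [← this]; exact hlost
    rw [nsmul_eq_mul] at h1
    have h4 : (bad.card : ℝ) * (η / 2) * n ≤ ρ * n * n := by nlinarith
    exact le_of_mul_le_mul_right h4 hnR
  have hbad1 : (bad.card : ℝ) ≤ η / 2 * n := by
    have : (bad.card : ℝ) * (η / 2) ≤ (η / 2 * n) * (η / 2) := by nlinarith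
    exact le_of_mul_le_mul_right this (by positivity)
  have hbad2 : (bad.card : ℝ) ≤ ε / 2 * n := by
    have : (bad.card : ℝ) * (η / 2) ≤ (ε / 2 * n) * (η / 2) := by nlinarith
    exact le_of_mul_le_mul_right this (by positivity)
  let W := {v : Fin n // v ∉ bad}
  have hcol : (G1.comap (Subtype.val : W → Fin n)).Colorable k := by
    refine hom_transfer H k c hc _
      ⟨fun f => hfree.false ((SimpleGraph.Hom.comap _ G1).comp f)⟩ ?_
    rintro ⟨v, hv⟩
    have hvD : ((D v).card : ℝ) ≤ η / 2 * n := by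
      simpa [bad] using hv
    have h1 : G.neighborSet v ⊆
        (Subtype.val '' ((G1.comap (Subtype.val : W → Fin n)).neighborSet ⟨v, hv⟩) ∪ (D v : Set _))
          ∪ (bad : Set (Fin n)) := by
      intro w hw
      by_cases h1 : w ∈ bad
      · right; exact h1
      left
      by_cases h2 : G1.Adj v w
      · left; exact ⟨⟨w, h1⟩, h2, rfl⟩
      · right
        simp only [D, Finset.coe_filter, Finset.mem_univ, true_and, Set.mem_setOf_eq]
        exact ⟨hw, h2⟩
    have h2 := (Set.ncard_le_ncard h1 (Set.toFinite _)).trans (Set.ncard_union_le _ _)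
    have h3 := Set.ncard_union_le
      (Subtype.val '' ((G1.comap (Subtype.val : W → Fin n)).neighborSet ⟨v, hv⟩)) (D v : Set _)
    rw [Set.ncard_image_of_injective _ Subtype.val_injective] at h3
    rw [Set.ncard_coe_finset] at h2 h3
    have h4 : (((G.neighborSet v).ncard : ℕ) : ℝ) ≤
        ((G1.comap (Subtype.val : W → Fin n)).neighborSet ⟨v, hv⟩).ncard + (D v).card
          + bad.card := by
      exact_mod_cast h2.trans (by omega)
    have h5 := hdeg v
    have h6 : (Fintype.card W : ℝ) ≤ n := by
      have := Fintype.card_subtype_le (fun v : Fin n => v ∉ bad)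
      rw [Fintype.card_fin] at this
      exact_mod_cast this
    have h7 : c * Fintype.card W ≤ c * n := by gcongr
    linarith
  obtain ⟨C⟩ := hcol
  let G2 : SimpleGraph (Fin n) :=
    { Adj := fun v w => G1.Adj v w ∧ v ∉ bad ∧ w ∉ bad
      symm := ⟨fun v w h => ⟨h.1.symm, h.2.2, h.2.1⟩⟩
      loopless := ⟨fun v h => G1.irrefl h.1⟩ }
  refine ⟨G2, fun v w h => hle h.1, ?_, ?_⟩
  · have hsub : G.edgeSet \ G2.edgeSet ⊆
        (fun p : Fin n × Fin n => s(p.1, p.2)) '' (T ∪ (bad : Set (Fin n)) ×ˢ Set.univ) := by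
      intro z
      induction z using Sym2.ind with
      | _ v w =>
        rintro ⟨h1, h2⟩
        rw [SimpleGraph.mem_edgeSet] at h1 h2
        by_cases hv : v ∈ bad
        · exact ⟨(v, w), Or.inr ⟨hv, trivial⟩, rfl⟩
        by_cases hw : w ∈ bad
        · exact ⟨(w, v), Or.inr ⟨hw, trivial⟩, Sym2.eq_swap⟩
        exact ⟨(v, w), Or.inl ⟨h1, fun h => h2 ⟨h, hv, hw⟩⟩, rfl⟩
    have h1 := (Set.ncard_le_ncard hsub (Set.toFinite _)).trans
      ((Set.ncard_image_le (Set.toFinite _)).trans (Set.ncard_union_le _ _))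
    rw [Set.ncard_prod, Set.ncard_coe_finset, Set.ncard_univ, Nat.card_eq_fintype_card,
      Fintype.card_fin] at h1
    have h2 : ((G.edgeSet \ G2.edgeSet).ncard : ℝ) ≤ T.ncard + bad.card * n := by
      exact_mod_cast h1
    nlinarith
  · refine ⟨SimpleGraph.Coloring.mk
      (fun v => if h : v ∉ bad then C ⟨v, h⟩ else ⟨0, hk⟩) ?_⟩
    intro v w hvw
    rw [dif_pos hvw.2.1, dif_pos hvw.2.2]
    exact C.valid hvw.1

/-- The approximate chromatic profile of `H` coincides with the chromatic profile of the
family of `H`-homomorphism-free graphs. -/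
theorem statement8 {α : Type*} [Fintype α] (H : SimpleGraph α) (k : ℕ) (hk : 0 < k) :
    deltaStar H k = deltaHom H k := by
  unfold deltaStar deltaHom
  apply le_antisymm
  · refine le_of_forall_pos_le_add fun η hη => ?_
    rw [← sub_le_iff_le_add]
    refine le_csInf ⟨1, zero_le_one, ?_⟩ ?_
    · intro n G _ hdeg
      rcases Nat.eq_zero_or_pos n with rfl | hn
      · exact ⟨SimpleGraph.Coloring.mk (fun v => v.elim0) (fun {v} => v.elim0)⟩
      · exfalso
        have h1 := hdeg ⟨0, hn⟩
        have h2 : (G.neighborSet ⟨0, hn⟩).ncard < (Set.univ : Set (Fin n)).ncard := by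
          apply Set.ncard_lt_ncard _ (Set.toFinite _)
          rw [Set.ssubset_univ_iff]
          intro h
          have : (⟨0, hn⟩ : Fin n) ∈ G.neighborSet ⟨0, hn⟩ := h ▸ Set.mem_univ _
          exact G.irrefl this
        rw [Set.ncard_univ, Nat.card_eq_fintype_card, Fintype.card_fin] at h2
        have h3 : ((G.neighborSet ⟨0, hn⟩).ncard : ℝ) < n := by exact_mod_cast h2
        linarith
    · rintro c ⟨hc0, hc⟩
      rw [sub_le_iff_le_add]
      refine csInf_le ⟨0, fun x hx => hx.1⟩ ⟨by positivity, fun ε hε => ?_⟩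
      exact dirTwo H k hk c hc0 hc η hη ε hε
  · refine le_csInf ⟨1, zero_le_one, ?_⟩ ?_
    · intro ε hε
      refine ⟨1, fun n hn G _ hdeg => ?_⟩
      exfalso
      have h1 := hdeg ⟨0, hn⟩
      have h2 : (G.neighborSet ⟨0, hn⟩).ncard < (Set.univ : Set (Fin n)).ncard := by
        apply Set.ncard_lt_ncard _ (Set.toFinite _)
        rw [Set.ssubset_univ_iff]
        intro h
        have : (⟨0, hn⟩ : Fin n) ∈ G.neighborSet ⟨0, hn⟩ := h ▸ Set.mem_univ _
        exact G.irrefl this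
      rw [Set.ncard_univ, Nat.card_eq_fintype_card, Fintype.card_fin] at h2
      have h3 : ((G.neighborSet ⟨0, hn⟩).ncard : ℝ) < n := by exact_mod_cast h2
      linarith
    · rintro c ⟨hc0, hc⟩
      exact csInf_le ⟨0, fun x hx => hx.1⟩ ⟨hc0, fun m G hG hdeg => dirOne H k hk c hc m G hG hdeg⟩
end

section
/- Let a ≥ 1 be an integer and let G be an a-locally bipartite simple graph on n vertices. If the minimum degree of G is strictly greater than (1 − 1/(a + 4/3))·n, then G is (a+2)-colourable. -/
open SimpleGraph

/-- `G` is `a`-locally bipartite: the common neighbourhood of every `a`-clique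
induces a bipartite (2-colourable) graph. -/
def LocallyBip {V : Type*} (a : ℕ) (G : SimpleGraph V) : Prop :=
  ∀ s : Finset V, G.IsNClique a s →
    (G.induce {v | ∀ u ∈ s, G.Adj u v}).Colorable 2

namespace LB

variable {V : Type*}

open Classical in
/-- part of `S` adjacent to `x` -/
noncomputable def nb (G : SimpleGraph V) (S : Finset V) (x : V) : Finset V :=
  S.filter (fun w => G.Adj x w)

open Classical in
/-- every vertex of `S` misses fewer than `3/d` of `S` -/
def Good (G : SimpleGraph V) (d : ℕ) (S : Finset V) : Prop :=
  ∀ v ∈ S, d * (S.filter (fun w => ¬ G.Adj v w)).card < 3 * S.card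

/-- `c` is a proper colouring of `S` with at most `k` colours -/
def Col (G : SimpleGraph V) (S : Finset V) (k : ℕ) (c : V → ℕ) : Prop :=
  ∃ K : Finset ℕ, K.card ≤ k ∧ (∀ u ∈ S, c u ∈ K) ∧ ∀ u ∈ S, ∀ v ∈ S, G.Adj u v → c u ≠ c v

variable {G : SimpleGraph V}

lemma mem_nb {S : Finset V} {x w : V} : w ∈ nb G S x ↔ w ∈ S ∧ G.Adj x w := by
  classical
  simp [nb]

open Classical in
lemma weight_swap (S : Finset V) (L : List (ℕ × V)) :
    ∑ s ∈ S, (L.map (fun p => if G.Adj s p.2 then 0 else p.1)).sum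
      = (L.map (fun p => p.1 * (S.filter (fun w => ¬ G.Adj p.2 w)).card)).sum := by
  induction L with
  | nil => simp
  | cons p L ih =>
    simp only [List.map_cons, List.sum_cons, Finset.sum_add_distrib, ih]
    congr 1
    rw [Finset.card_filter, Finset.mul_sum]
    refine Finset.sum_congr rfl fun s _ => ?_
    by_cases h : G.Adj s p.2
    · simp [h, h.symm]
    · have h' : ¬ G.Adj p.2 s := fun h'' => h h''.symm
      simp [h, h']

open Classical in
lemma weight_bound {d : ℕ} {S : Finset V} (hG : Good G d S) (L : List (ℕ × V))
    (hL : ∀ p ∈ L, p.2 ∈ S) :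
    d * (L.map (fun p => p.1 * (S.filter (fun w => ¬ G.Adj p.2 w)).card)).sum
      ≤ 3 * S.card * (L.map Prod.fst).sum ∧
    (0 < (L.map Prod.fst).sum →
    d * (L.map (fun p => p.1 * (S.filter (fun w => ¬ G.Adj p.2 w)).card)).sum
      < 3 * S.card * (L.map Prod.fst).sum) := by
  induction L with
  | nil => simp
  | cons p L ih =>
    have hp := hG p.2 (hL p (by simp))
    obtain ⟨i1, i2⟩ := ih (fun q hq => hL q (by simp [hq]))
    simp only [List.map_cons, List.sum_cons]
    set A := (S.filter (fun w => ¬ G.Adj p.2 w)).card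
    set B := (L.map (fun p => p.1 * (S.filter (fun w => ¬ G.Adj p.2 w)).card)).sum
    set W := (L.map Prod.fst).sum
    constructor
    · nlinarith
    · intro h
      rcases Nat.eq_zero_or_pos p.1 with h0 | h0
      · rw [h0] at h ⊢
        have := i2 (by omega)
        simpa using this
      · nlinarith

open Classical in
lemma pigeon {d : ℕ} {S : Finset V} (hG : Good G d S) (L : List (ℕ × V))
    (hL : ∀ p ∈ L, p.2 ∈ S) (hW : 0 < (L.map Prod.fst).sum) :
    ∃ s ∈ S, d * (L.map (fun p => if G.Adj s p.2 then 0 else p.1)).sum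
      < 3 * (L.map Prod.fst).sum := by
  by_contra hcon
  push Not at hcon
  have h1 := (weight_bound hG L hL).2 hW
  rw [← weight_swap, Finset.mul_sum] at h1
  have h2 := Finset.sum_le_sum hcon
  rw [Finset.sum_const, smul_eq_mul] at h2
  nlinarith

lemma common2 {d : ℕ} {S : Finset V} (hG : Good G d S) (hd : 6 ≤ d) {u v : V}
    (hu : u ∈ S) (hv : v ∈ S) : ∃ s ∈ S, G.Adj s u ∧ G.Adj s v := by
  classical
  obtain ⟨s, hs, h⟩ := pigeon hG [(1, u), (1, v)] (by simp [hu, hv]) (by simp)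
  refine ⟨s, hs, ?_⟩
  simp only [List.map_cons, List.map_nil, List.sum_cons, List.sum_nil] at h
  split_ifs at h <;> first | (exfalso; omega) | tauto

lemma common3 {d : ℕ} {S : Finset V} (hG : Good G d S) (hd : 9 ≤ d) {u v w : V}
    (hu : u ∈ S) (hv : v ∈ S) (hw : w ∈ S) : ∃ s ∈ S, G.Adj s u ∧ G.Adj s v ∧ G.Adj s w := by
  classical
  obtain ⟨s, hs, h⟩ := pigeon hG [(1, u), (1, v), (1, w)] (by simp [hu, hv, hw]) (by simp)
  refine ⟨s, hs, ?_⟩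
  simp only [List.map_cons, List.map_nil, List.sum_cons, List.sum_nil] at h
  split_ifs at h <;> first | (exfalso; omega) | tauto

lemma common4 {d : ℕ} {S : Finset V} (hG : Good G d S) (hd : 12 ≤ d) {u v w x : V}
    (hu : u ∈ S) (hv : v ∈ S) (hw : w ∈ S) (hx : x ∈ S) :
    ∃ s ∈ S, G.Adj s u ∧ G.Adj s v ∧ G.Adj s w ∧ G.Adj s x := by
  classical
  obtain ⟨s, hs, h⟩ := pigeon hG [(1, u), (1, v), (1, w), (1, x)]
    (by simp [hu, hv, hw, hx]) (by simp)
  refine ⟨s, hs, ?_⟩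
  simp only [List.map_cons, List.map_nil, List.sum_cons, List.sum_nil] at h
  split_ifs at h <;> first | (exfalso; omega) | tauto

lemma common1 {d : ℕ} {S : Finset V} (hG : Good G d S) (hd : 3 ≤ d) {u : V}
    (hu : u ∈ S) : ∃ s ∈ S, G.Adj s u := by
  classical
  obtain ⟨s, hs, h⟩ := pigeon hG [(1, u)] (by simp [hu]) (by simp)
  refine ⟨s, hs, ?_⟩
  simp only [List.map_cons, List.map_nil, List.sum_cons, List.sum_nil] at h
  split_ifs at h <;> first | (exfalso; omega) | tauto

lemma good_nb {d : ℕ} {S : Finset V} (hG : Good G (d + 3) S) {x : V} (hx : x ∈ S) :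
    Good G d (nb G S x) := by
  classical
  intro v hv
  have hvS := (mem_nb.1 hv).1
  have h1 := hG v hvS
  have h2 := hG x hx
  have h3 : (nb G S x).card + (S.filter (fun w => ¬ G.Adj x w)).card = S.card := by
    unfold nb
    convert Finset.card_filter_add_card_filter_not (s := S) (fun w => G.Adj x w) using 2
  have h4 : ((nb G S x).filter (fun w => ¬ G.Adj v w)).card
      ≤ (S.filter (fun w => ¬ G.Adj v w)).card := by
    apply Finset.card_le_card
    intro w hw
    simp only [Finset.mem_filter, mem_nb] at hw ⊢
    exact ⟨hw.1.1, hw.2⟩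
  set f := (S.filter (fun w => ¬ G.Adj v w)).card
  set g := (S.filter (fun w => ¬ G.Adj x w)).card
  set m := ((nb G S x).filter (fun w => ¬ G.Adj v w)).card
  set N := (nb G S x).card
  have h5 : (d + 3) * (d * m) < (d + 3) * (3 * N) := by
    have : d * m ≤ d * f := Nat.mul_le_mul_left _ h4
    nlinarith
  exact Nat.lt_of_mul_lt_mul_left h5

lemma col_mono {S T : Finset V} {k : ℕ} {c : V → ℕ} (h : Col G S k c) (hT : T ⊆ S) :
    Col G T k c := by
  obtain ⟨K, h1, h2, h3⟩ := h
  exact ⟨K, h1, fun u hu => h2 u (hT hu), fun u hu v hv => h3 u (hT hu) v (hT hv)⟩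

lemma col_nb {S : Finset V} {k : ℕ} {c : V → ℕ} (h : Col G S (k + 1) c) {x : V} (hx : x ∈ S) :
    Col G (nb G S x) k c := by
  obtain ⟨K, h1, h2, h3⟩ := h
  refine ⟨K.erase (c x), ?_, ?_, ?_⟩
  · rw [Finset.card_erase_of_mem (h2 x hx)]; omega
  · intro u hu
    rw [mem_nb] at hu
    exact Finset.mem_erase.2 ⟨(h3 x hx u hu.1 hu.2).symm, h2 u hu.1⟩
  · intro u hu v hv
    exact h3 u (mem_nb.1 hu).1 v (mem_nb.1 hv).1

/-- size of colour classes -/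
lemma col_bound {d k : ℕ} {S : Finset V} (hG : Good G d S) (hS : S.Nonempty) {c : V → ℕ}
    (h : Col G S k c) : d < 3 * k := by
  classical
  obtain ⟨K, h1, h2, h3⟩ := h
  have hK : K.Nonempty := by
    obtain ⟨u, hu⟩ := hS
    exact ⟨_, h2 u hu⟩
  have hs : S.card = ∑ j ∈ K, (S.filter (fun u => c u = j)).card :=
    Finset.card_eq_sum_card_fiberwise (fun u hu => h2 u hu)
  have hb : ∀ j ∈ K, d * (S.filter (fun u => c u = j)).card < 3 * S.card := by
    intro j _
    by_cases he : (S.filter (fun u => c u = j)).Nonempty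
    · obtain ⟨v, hv⟩ := he
      rw [Finset.mem_filter] at hv
      refine lt_of_le_of_lt (Nat.mul_le_mul_left _ (Finset.card_le_card ?_)) (hG v hv.1)
      intro w hw
      rw [Finset.mem_filter] at hw ⊢
      exact ⟨hw.1, fun ha => h3 v hv.1 w hw.1 ha (hv.2.trans hw.2.symm)⟩
    · rw [Finset.not_nonempty_iff_eq_empty] at he
      have := hS.card_pos
      rw [he]; simp; omega
  have h5 := Finset.sum_lt_sum_of_nonempty hK hb
  rw [← Finset.mul_sum, ← hs, Finset.sum_const, smul_eq_mul] at h5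
  have := hS.card_pos
  by_contra hcon
  push Not at hcon
  nlinarith

lemma two_col {S : Finset V} {c : V → ℕ} (h : Col G S 2 c) {u v w : V} (hu : u ∈ S)
    (hv : v ∈ S) (hw : w ∈ S) (h1 : c u ≠ c v) (h2 : c u ≠ c w) : c v = c w := by
  obtain ⟨K, k1, k2, _⟩ := h
  by_contra h3
  have : ({c u, c v, c w} : Finset ℕ).card ≤ K.card := by
    apply Finset.card_le_card
    intro j hj
    simp only [Finset.mem_insert, Finset.mem_singleton] at hj
    rcases hj with rfl | rfl | rfl
    exacts [k2 u hu, k2 v hv, k2 w hw]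
  rw [Finset.card_eq_three.2 ⟨_, _, _, h1, h2, h3, rfl⟩] at this
  omega

lemma adj_ne {S : Finset V} {k : ℕ} {c : V → ℕ} (h : Col G S k c) {u v : V} (hu : u ∈ S)
    (hv : v ∈ S) (h1 : G.Adj u v) : c u ≠ c v := by
  obtain ⟨K, k1, k2, k3⟩ := h
  exact k3 u hu v hv h1

lemma dist3 {S : Finset V} (hG : Good G 4 S) {c : V → ℕ} (h : Col G S 2 c) {u v : V}
    (hu : u ∈ S) (hv : v ∈ S) (huv : c u ≠ c v) :
    ∃ s ∈ S, ∃ t ∈ S, G.Adj u s ∧ G.Adj s t ∧ G.Adj t v := by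
  classical
  by_contra hcon
  push Not at hcon
  obtain ⟨s, hs, hsu⟩ := common1 hG (by norm_num) hu
  obtain ⟨t, ht, htv⟩ := common1 hG (by norm_num) hv
  obtain ⟨z, hz, hh⟩ := pigeon hG [(1, u), (1, v), (1, s), (1, t)]
    (by simp [hu, hv, hs, ht]) (by simp)
  have c1 := adj_ne h hs hu hsu
  have c2 := adj_ne h ht hv htv
  have n1 : G.Adj z u → c z ≠ c u := adj_ne h hz hu
  have n2 : G.Adj z v → c z ≠ c v := adj_ne h hz hv
  have n3 : G.Adj z s → c z ≠ c s := adj_ne h hz hs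
  have n4 : G.Adj z t → c z ≠ c t := adj_ne h hz ht
  have e1 : c s = c v := two_col h hu hs hv c1.symm huv
  have e2 : c t = c u := two_col h hv ht hu c2.symm huv.symm
  have e3 : c z ≠ c u → c z = c v := fun hh => (two_col h hu hz hv hh.symm huv)
  have p1 : G.Adj z u → G.Adj z t → False := fun a b => hcon z hz t ht a.symm b htv
  have p2 : G.Adj z s → G.Adj z v → False := fun a b => hcon s hs z hz hsu.symm a.symm b
  simp only [List.map_cons, List.map_nil, List.sum_cons, List.sum_nil] at hh
  split_ifs at hh <;> first | (exfalso; omega) | grind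

/-- uniqueness of colourings -/
lemma unique_col (k : ℕ) : ∀ (S : Finset V), Good G (3 * k + 1) S → ∀ c c' : V → ℕ,
    Col G S (k + 1) c → Col G S (k + 1) c' → ∀ u ∈ S, ∀ v ∈ S, c u = c v → c' u = c' v := by
  induction k with
  | zero =>
    intro S _ c c' _ h u hu v hv _
    obtain ⟨K, k1, k2, _⟩ := h
    exact Finset.card_le_one.1 k1 _ (k2 u hu) _ (k2 v hv)
  | succ k ih =>
    intro S hG c c' h h' u hu v hv huv
    rcases Nat.eq_zero_or_pos k with rfl | hk
    · obtain ⟨m, hm, hmu⟩ := common1 hG (by norm_num) hu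
      have c1 := adj_ne h hm hu hmu
      obtain ⟨s, hs, t, ht, a1, a2, a3⟩ := dist3 hG h hm hv (by rwa [← huv])
      have b0 := adj_ne h' hm hu hmu
      have b1 := adj_ne h' hm hs a1
      have b2 := adj_ne h' hs ht a2
      have b3 := adj_ne h' ht hv a3
      have e1 := two_col h' hm hu hs b0 b1
      have e2 := two_col h' ht hs hv b2.symm b3
      exact e1.trans e2
    · obtain ⟨x, hx, xu, xv⟩ := common2 hG (by omega) hu hv
      exact ih (nb G S x) (good_nb hG hx) c c' (col_nb h hx) (col_nb h' hx) u
        (mem_nb.2 ⟨hu, xu⟩) v (mem_nb.2 ⟨hv, xv⟩) huv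

/-- a family of proper colourings of all neighbourhoods in `S` -/
def LCol (G : SimpleGraph V) (S : Finset V) (k : ℕ) (c : V → V → ℕ) : Prop :=
  ∀ x ∈ S, Col G (nb G S x) k (c x)

lemma consist {S : Finset V} {k : ℕ} {c : V → V → ℕ} (hG : Good G (3 * k + 7) S)
    (h : LCol G S (k + 2) c) {x z u v : V} (hx : x ∈ S) (hz : z ∈ S) (hu : u ∈ S) (hv : v ∈ S)
    (xz : G.Adj x z) (xu : G.Adj x u) (xv : G.Adj x v) (zu : G.Adj z u) (zv : G.Adj z v)
    (he : c x u = c x v) : c z u = c z v := by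
  have hzx : z ∈ nb G S x := mem_nb.2 ⟨hz, xz⟩
  have hxz : x ∈ nb G S z := mem_nb.2 ⟨hx, xz.symm⟩
  have g1 : Good G (3 * k + 1) (nb G (nb G S x) z) := good_nb (good_nb hG hx) hzx
  have c1 : Col G (nb G (nb G S x) z) (k + 1) (c x) := col_nb (h x hx) hzx
  have c2 : Col G (nb G (nb G S x) z) (k + 1) (c z) := by
    refine col_mono (col_nb (h z hz) hxz) ?_
    intro w hw
    simp only [mem_nb] at hw ⊢
    tauto
  exact unique_col k _ g1 _ _ c1 c2 u (by simp only [mem_nb]; tauto) v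
    (by simp only [mem_nb]; tauto) he

/-- well-definedness of the relation -/
def Well (G : SimpleGraph V) (S : Finset V) (c : V → V → ℕ) : Prop :=
  ∀ u ∈ S, ∀ v ∈ S, ∀ x ∈ S, ∀ y ∈ S, G.Adj x u → G.Adj x v → G.Adj y u → G.Adj y v →
    c x u = c x v → c y u = c y v

/-- the relation: same colour at some common neighbour -/
def Rel (G : SimpleGraph V) (S : Finset V) (c : V → V → ℕ) (u v : V) : Prop :=
  ∃ x ∈ S, G.Adj x u ∧ G.Adj x v ∧ c x u = c x v

/-- transitivity -/
def Trans (G : SimpleGraph V) (S : Finset V) (c : V → V → ℕ) : Prop :=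
  ∀ u ∈ S, ∀ v ∈ S, ∀ w ∈ S, Rel G S c u v → Rel G S c v w → Rel G S c u w

lemma Rel.symm {S : Finset V} {c : V → V → ℕ} {u v : V} (h : Rel G S c u v) : Rel G S c v u := by
  obtain ⟨x, hx, a, b, e⟩ := h
  exact ⟨x, hx, b, a, e.symm⟩

lemma finish {S : Finset V} {k : ℕ} {c : V → V → ℕ} (hG : Good G (3 * k + 7) S)
    (h : LCol G S (k + 2) c) (hW : Well G S c) (hT : Trans G S c) :
    ∃ f : V → ℕ, Col G S (k + 3) f := by
  classical
  rcases S.eq_empty_or_nonempty with rfl | ⟨x₀, hx₀⟩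
  · exact ⟨fun _ => 0, ∅, by simp, by simp, by simp⟩
  -- adjacent vertices are never related
  have hind : ∀ u ∈ S, ∀ v ∈ S, G.Adj u v → ¬ Rel G S c u v := by
    rintro u hu v hv huv ⟨x, hx, a, b, e⟩
    exact adj_ne (h x hx) (mem_nb.2 ⟨hu, a⟩) (mem_nb.2 ⟨hv, b⟩) huv e
  have hcl : ∀ w ∈ S, ¬ Rel G S c w x₀ → ∃ u ∈ nb G S x₀, Rel G S c u w := by
    intro w hw hn
    by_contra hcon
    push Not at hcon
    obtain ⟨y, hy, yw, yx⟩ := common2 hG (by omega) hw hx₀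
    have hxy : x₀ ∈ nb G S y := mem_nb.2 ⟨hx₀, yx⟩
    have hwy : w ∈ nb G S y := mem_nb.2 ⟨hw, yw⟩
    have g1 : Good G (3 * k + 4) (nb G S y) := good_nb hG hy
    have g2 : Good G (3 * k + 1) (nb G (nb G S y) x₀) := good_nb g1 hxy
    have hne : (nb G (nb G S y) x₀).Nonempty := by
      obtain ⟨s, hs, hsx⟩ := common1 g1 (by omega) hxy
      exact ⟨s, mem_nb.2 ⟨hs, hsx.symm⟩⟩
    obtain ⟨K, k1, k2, k3⟩ := h y hy
    have hcne : c y w ≠ c y x₀ := fun e => hn ⟨y, hy, yw, yx, e⟩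
    have : Col G (nb G (nb G S y) x₀) k (c y) := by
      refine ⟨(K.erase (c y x₀)).erase (c y w), ?_, ?_, ?_⟩
      · rw [Finset.card_erase_of_mem, Finset.card_erase_of_mem (k2 _ hxy)]
        · omega
        · exact Finset.mem_erase.2 ⟨hcne, k2 _ hwy⟩
      · intro u hu
        have hu1 := (mem_nb.1 hu).1
        have hu2 := (mem_nb.1 hu).2
        refine Finset.mem_erase.2 ⟨?_, Finset.mem_erase.2 ⟨(k3 _ hxy _ hu1 hu2).symm, k2 _ hu1⟩⟩
        intro e
        exact hcon u (mem_nb.2 ⟨(mem_nb.1 hu1).1, hu2⟩) ⟨y, hy, (mem_nb.1 hu1).2, yw, e⟩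
      · intro u hu v hv
        exact k3 u (mem_nb.1 hu).1 v (mem_nb.1 hv).1
    have := col_bound g2 hne this
    omega
  obtain ⟨K, k1, k2, k3⟩ := h x₀ hx₀
  obtain ⟨M, hM⟩ : ∃ M, M ∉ K := Infinite.exists_notMem_finset K
  let f : V → ℕ := fun w => if hw : ∃ u ∈ nb G S x₀, Rel G S c u w then c x₀ hw.choose else M
  refine ⟨f, insert M K, ?_, ?_, ?_⟩
  · rw [Finset.card_insert_of_notMem hM]; omega
  · intro w _
    by_cases hw : ∃ u ∈ nb G S x₀, Rel G S c u w
    · simp only [f, dif_pos hw]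
      exact Finset.mem_insert_of_mem (k2 _ hw.choose_spec.1)
    · simp only [f, dif_neg hw]
      exact Finset.mem_insert_self _ _
  · intro w hw w' hw' ha he
    apply hind w hw w' hw' ha
    by_cases h1 : ∃ u ∈ nb G S x₀, Rel G S c u w <;>
      by_cases h2 : ∃ u ∈ nb G S x₀, Rel G S c u w'
    · simp only [f, dif_pos h1, dif_pos h2] at he
      obtain ⟨p1, p2⟩ := h1.choose_spec
      obtain ⟨q1, q2⟩ := h2.choose_spec
      have m1 := mem_nb.1 p1
      have m2 := mem_nb.1 q1
      have r : Rel G S c h1.choose h2.choose := ⟨x₀, hx₀, m1.2, m2.2, he⟩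
      exact hT _ hw _ m1.1 _ hw' p2.symm (hT _ m1.1 _ m2.1 _ hw' r q2)
    · simp only [f, dif_pos h1, dif_neg h2] at he
      exact absurd (he ▸ k2 _ h1.choose_spec.1) hM
    · simp only [f, dif_neg h1, dif_pos h2] at he
      exact absurd (he ▸ k2 _ h2.choose_spec.1) hM
    · have r1 : Rel G S c w x₀ := by
        by_contra hh; exact h1 (hcl w hw hh)
      have r2 : Rel G S c w' x₀ := by
        by_contra hh; exact h2 (hcl w' hw' hh)
      exact hT _ hw _ hx₀ _ hw' r1 r2.symm

lemma trans_of_well {S : Finset V} {d : ℕ} {c : V → V → ℕ} (hG : Good G d S) (hd : 9 ≤ d)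
    (hW : Well G S c) : Trans G S c := by
  rintro u hu v hv w hw ⟨x, hx, xu, xv, ex⟩ ⟨y, hy, yv, yw, ey⟩
  obtain ⟨z, hz, zu, zv, zw⟩ := common3 hG hd hu hv hw
  exact ⟨z, hz, zu, zw, (hW u hu v hv x hx z hz xu xv zu zv ex).trans
    (hW v hv w hw y hy z hz yv yw zv zw ey)⟩

lemma well_big {S : Finset V} {k : ℕ} {c : V → V → ℕ} (hk : 2 ≤ k) (hG : Good G (3 * k + 7) S)
    (h : LCol G S (k + 2) c) : Well G S c := by
  intro u hu v hv x hx y hy xu xv yu yv e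
  obtain ⟨z, hz, zu, zv, zx, zy⟩ := common4 hG (by omega) hu hv hx hy
  exact consist hG h hz hy hu hv zy zu zv yu yv (consist hG h hx hz hu hv zx.symm xu xv zu zv e)

set_option maxHeartbeats 4000000

lemma no4 {S : Finset V} {c : V → ℕ} (h : Col G S 3 c) {u v w x : V} (hu : u ∈ S)
    (hv : v ∈ S) (hw : w ∈ S) (hx : x ∈ S) (h1 : c u ≠ c v) (h2 : c u ≠ c w) (h3 : c u ≠ c x)
    (h4 : c v ≠ c w) (h5 : c v ≠ c x) (h6 : c w ≠ c x) : False := by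
  obtain ⟨K, k1, k2, _⟩ := h
  have : ({c u, c v, c w, c x} : Finset ℕ).card ≤ K.card := by
    apply Finset.card_le_card
    intro j hj
    simp only [Finset.mem_insert, Finset.mem_singleton] at hj
    rcases hj with rfl | rfl | rfl | rfl
    exacts [k2 u hu, k2 v hv, k2 w hw, k2 x hx]
  rw [Finset.card_insert_of_notMem (by simp [h1, h2, h3]),
    Finset.card_eq_three.2 ⟨_, _, _, h4, h5, h6, rfl⟩] at this
  omega

lemma well_three {S : Finset V} {c : V → V → ℕ} (hG : Good G 10 S)
    (h : LCol G S 3 c) : Well G S c := by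
  classical
  intro u hu v hv x hx y hy xu xv yu yv ex
  by_contra ey
  -- no edges between the two kinds of common neighbours
  have hno : ∀ p ∈ S, ∀ q ∈ S, G.Adj p u → G.Adj p v → G.Adj q u → G.Adj q v →
      c p u = c p v → c q u ≠ c q v → ¬ G.Adj p q := by
    intro p hp q hq pu pv qu qv e1 e2 pq
    exact e2 (consist (k := 1) hG h hp hq hu hv pq pu pv qu qv e1)
  have hK5 : ∀ a ∈ S, ∀ p ∈ S, ∀ q ∈ S, ∀ r ∈ S, ∀ s ∈ S, G.Adj s a → G.Adj s p → G.Adj s q →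
      G.Adj s r → G.Adj p a → G.Adj q a → G.Adj r a → G.Adj p q → G.Adj p r → G.Adj q r →
      False := by
    intro a ha p hp q hq r hr s hs sa sp sq sr pa qa ra pq pr qr
    have ha' := mem_nb.2 ⟨ha, sa⟩
    have hp' := mem_nb.2 ⟨hp, sp⟩
    have hq' := mem_nb.2 ⟨hq, sq⟩
    have hr' := mem_nb.2 ⟨hr, sr⟩
    have hc := h s hs
    exact no4 hc ha' hp' hq' hr' (adj_ne hc ha' hp' pa.symm) (adj_ne hc ha' hq' qa.symm)
      (adj_ne hc ha' hr' ra.symm) (adj_ne hc hp' hq' pq) (adj_ne hc hp' hr' pr)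
      (adj_ne hc hq' hr' qr)
  have htf : ∀ p ∈ S, ∀ q ∈ S, ∀ r ∈ S, G.Adj p u → G.Adj p v → G.Adj q u → G.Adj q v →
      G.Adj r u → G.Adj r v → c p u ≠ c p v → G.Adj p q → G.Adj p r → G.Adj q r → False := by
    intro p hp q hq r hr pu pv qu qv ru rv e pq pr qr
    have hc := h p hp
    have hu' := mem_nb.2 ⟨hu, pu⟩
    have hv' := mem_nb.2 ⟨hv, pv⟩
    have hq' := mem_nb.2 ⟨hq, pq⟩
    have hr' := mem_nb.2 ⟨hr, pr⟩
    exact no4 hc hu' hv' hq' hr' e (adj_ne hc hu' hq' qu.symm) (adj_ne hc hu' hr' ru.symm)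
      (adj_ne hc hv' hq' qv.symm) (adj_ne hc hv' hr' rv.symm) (adj_ne hc hq' hr' qr)
  obtain ⟨y', hy', y'u, y'v, y'y⟩ := common3 hG (by norm_num) hu hv hy
  obtain ⟨x', hx', x'u, x'v, x'x⟩ := common3 hG (by norm_num) hu hv hx
  have ey' : c y' u ≠ c y' v := fun e => hno y' hy' y hy y'u y'v yu yv e ey y'y
  have ex' : c x' u = c x' v := by
    by_contra e
    exact hno x hx x' hx' xu xv x'u x'v ex e x'x.symm
  by_cases htri : ∃ p ∈ S, ∃ q ∈ S, ∃ r ∈ S, (G.Adj p u ∧ G.Adj p v ∧ c p u = c p v) ∧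
      (G.Adj q u ∧ G.Adj q v ∧ c q u = c q v) ∧ (G.Adj r u ∧ G.Adj r v ∧ c r u = c r v) ∧
      G.Adj p q ∧ G.Adj p r ∧ G.Adj q r
  · obtain ⟨p, hp, q, hq, r, hr, ⟨pu, pv, ep⟩, ⟨qu, qv, eq⟩, ⟨ru, rv, er⟩, pq, pr, qr⟩ := htri
    obtain ⟨s, hs, hh⟩ := pigeon hG
      [(5, u), (5, v), (2, p), (2, q), (2, r), (2, y), (2, y')]
      (by simp [hu, hv, hp, hq, hr, hy, hy']) (by simp)
    have f1 : G.Adj s u → G.Adj s p → G.Adj s q → G.Adj s r → False := fun a b c d =>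
      hK5 u hu p hp q hq r hr s hs a b c d pu qu ru pq pr qr
    have f2 : G.Adj s v → G.Adj s p → G.Adj s q → G.Adj s r → False := fun a b c d =>
      hK5 v hv p hp q hq r hr s hs a b c d pv qv rv pq pr qr
    have f3 : G.Adj s u → G.Adj s v → c s u = c s v → ¬ G.Adj s y ∧ ¬ G.Adj s y' := fun a b e =>
      ⟨hno s hs y hy a b yu yv e ey, hno s hs y' hy' a b y'u y'v e ey'⟩
    have f4 : G.Adj s u → G.Adj s v → c s u ≠ c s v →
        ¬ G.Adj s p ∧ ¬ G.Adj s q ∧ ¬ G.Adj s r := fun a b e =>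
      ⟨fun hh => hno p hp s hs pu pv a b ep e hh.symm,
        fun hh => hno q hq s hs qu qv a b eq e hh.symm,
        fun hh => hno r hr s hs ru rv a b er e hh.symm⟩
    simp only [List.map_cons, List.map_nil, List.sum_cons, List.sum_nil] at hh
    clear hno hK5 htf
    by_cases e : c s u = c s v
    · split_ifs at hh <;> first | (exfalso; omega) | exact f1 ‹_› ‹_› ‹_› ‹_› | exact f2 ‹_› ‹_› ‹_› ‹_› | exact (f3 ‹_› ‹_› ‹_›).1 ‹_› | exact (f3 ‹_› ‹_› ‹_›).2 ‹_›
    · split_ifs at hh <;> first | (exfalso; omega) | exact f1 ‹_› ‹_› ‹_› ‹_› | exact f2 ‹_› ‹_› ‹_› ‹_› | exact (f4 ‹_› ‹_› ‹_›).1 ‹_› | exact (f4 ‹_› ‹_› ‹_›).2.1 ‹_› | exact (f4 ‹_› ‹_› ‹_›).2.2 ‹_›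
  · push Not at htri
    obtain ⟨s, hs, hh⟩ := pigeon hG [(3, u), (3, v), (1, x), (1, x'), (1, y), (1, y')]
      (by simp [hu, hv, hx, hy, hx', hy']) (by simp)
    have f3 : G.Adj s u → G.Adj s v → c s u = c s v → ¬ G.Adj s y ∧ ¬ G.Adj s y' := fun a b e =>
      ⟨hno s hs y hy a b yu yv e ey, hno s hs y' hy' a b y'u y'v e ey'⟩
    have f4 : G.Adj s u → G.Adj s v → c s u ≠ c s v →
        ¬ G.Adj s x ∧ ¬ G.Adj s x' := fun a b e =>
      ⟨fun hh => hno x hx s hs xu xv a b ex e hh.symm,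
        fun hh => hno x' hx' s hs x'u x'v a b ex' e hh.symm⟩
    have f5 : G.Adj s u → G.Adj s v → c s u = c s v → G.Adj s x → G.Adj s x' → False :=
      fun a b e p q => htri s hs x' hx' x hx ⟨a, b, e⟩ ⟨x'u, x'v, ex'⟩ ⟨xu, xv, ex⟩ q p x'x
    have f6 : G.Adj s u → G.Adj s v → c s u ≠ c s v → G.Adj s y → G.Adj s y' → False :=
      fun a b e p q => htf s hs y' hy' y hy a b y'u y'v yu yv e q p y'y
    simp only [List.map_cons, List.map_nil, List.sum_cons, List.sum_nil] at hh
    clear hno hK5 htf htri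
    by_cases e : c s u = c s v
    · split_ifs at hh <;> first | (exfalso; omega) | exact (f3 ‹_› ‹_› ‹_›).1 ‹_› | exact (f3 ‹_› ‹_› ‹_›).2 ‹_› | exact f5 ‹_› ‹_› ‹_› ‹_› ‹_›
    · split_ifs at hh <;> first | (exfalso; omega) | exact (f4 ‹_› ‹_› ‹_›).1 ‹_› | exact (f4 ‹_› ‹_› ‹_›).2 ‹_› | exact f6 ‹_› ‹_› ‹_› ‹_› ‹_›

/-- dense pairs -/
def Dn (G : SimpleGraph V) (S : Finset V) (u v : V) : Prop :=
  ∃ p ∈ S, ∃ q ∈ S, G.Adj p q ∧ G.Adj p u ∧ G.Adj p v ∧ G.Adj q u ∧ G.Adj q v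

lemma Dn.symm {S : Finset V} {u v : V} (h : Dn G S u v) : Dn G S v u := by
  obtain ⟨p, hp, q, hq, a, b, c, d, e⟩ := h
  exact ⟨p, hp, q, hq, a, c, b, e, d⟩

lemma noK4 {S : Finset V} {c : V → V → ℕ} (h : LCol G S 2 c) {s p q r : V} (hs : s ∈ S)
    (hp : p ∈ S) (hq : q ∈ S) (hr : r ∈ S) (pq : G.Adj p q) (pr : G.Adj p r) (qr : G.Adj q r)
    (sp : G.Adj s p) (sq : G.Adj s q) (sr : G.Adj s r) : False := by
  have hc := h s hs
  have hp' := mem_nb.2 ⟨hp, sp⟩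
  have hq' := mem_nb.2 ⟨hq, sq⟩
  have hr' := mem_nb.2 ⟨hr, sr⟩
  exact adj_ne hc hq' hr' qr (two_col hc hp' hq' hr' (adj_ne hc hp' hq' pq) (adj_ne hc hp' hr' pr))

lemma noW5 {S : Finset V} {c : V → V → ℕ} (h : LCol G S 2 c) {s u v w p r : V} (hs : s ∈ S)
    (hu : u ∈ S) (hv : v ∈ S) (hw : w ∈ S) (hp : p ∈ S) (hr : r ∈ S)
    (up : G.Adj p u) (pv : G.Adj p v) (vr : G.Adj r v) (rw : G.Adj r w) (uw : G.Adj u w)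
    (su : G.Adj s u) (sv : G.Adj s v) (sw : G.Adj s w) (sp : G.Adj s p) (sr : G.Adj s r) :
    False := by
  have hc := h s hs
  have hu' := mem_nb.2 ⟨hu, su⟩
  have hv' := mem_nb.2 ⟨hv, sv⟩
  have hw' := mem_nb.2 ⟨hw, sw⟩
  have hp' := mem_nb.2 ⟨hp, sp⟩
  have hr' := mem_nb.2 ⟨hr, sr⟩
  have e1 := two_col hc hp' hu' hv' (adj_ne hc hp' hu' up) (adj_ne hc hp' hv' pv)
  have e2 := two_col hc hr' hv' hw' (adj_ne hc hr' hv' vr) (adj_ne hc hr' hw' rw)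
  exact adj_ne hc hu' hw' uw (e1.trans e2)

lemma spindle {S : Finset V} {c : V → V → ℕ} (hG : Good G 7 S) (h : LCol G S 2 c) {u v w : V}
    (hu : u ∈ S) (hv : v ∈ S) (hw : w ∈ S) (d1 : Dn G S u v) (d2 : Dn G S v w)
    (uw : G.Adj u w) : False := by
  classical
  obtain ⟨p, hp, q, hq, pq, pu, pv, qu, qv⟩ := d1
  obtain ⟨r, hr, t, ht, rt, rv, rw, tv, tw⟩ := d2
  obtain ⟨s, hs, hh⟩ := pigeon hG [(1, u), (1, v), (1, w), (1, p), (1, q), (1, r), (1, t)]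
    (by simp [hu, hv, hw, hp, hq, hr, ht]) (by simp)
  have f1 : G.Adj s p → G.Adj s q → G.Adj s u → False := noK4 h hs hp hq hu pq pu qu
  have f2 : G.Adj s p → G.Adj s q → G.Adj s v → False := noK4 h hs hp hq hv pq pv qv
  have f3 : G.Adj s r → G.Adj s t → G.Adj s v → False := noK4 h hs hr ht hv rt rv tv
  have f4 : G.Adj s r → G.Adj s t → G.Adj s w → False := noK4 h hs hr ht hw rt rw tw
  have g1 : G.Adj s u → G.Adj s v → G.Adj s w → G.Adj s p → G.Adj s r → False :=
    noW5 h hs hu hv hw hp hr pu pv rv rw uw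
  have g2 : G.Adj s u → G.Adj s v → G.Adj s w → G.Adj s q → G.Adj s r → False :=
    noW5 h hs hu hv hw hq hr qu qv rv rw uw
  have g3 : G.Adj s u → G.Adj s v → G.Adj s w → G.Adj s p → G.Adj s t → False :=
    noW5 h hs hu hv hw hp ht pu pv tv tw uw
  have g4 : G.Adj s u → G.Adj s v → G.Adj s w → G.Adj s q → G.Adj s t → False :=
    noW5 h hs hu hv hw hq ht qu qv tv tw uw
  simp only [List.map_cons, List.map_nil, List.sum_cons, List.sum_nil] at hh
  split_ifs at hh <;> first
      | (exfalso; omega)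
      | exact f1 ‹_› ‹_› ‹_›
      | exact f2 ‹_› ‹_› ‹_›
      | exact f3 ‹_› ‹_› ‹_›
      | exact f4 ‹_› ‹_› ‹_›
      | exact g1 ‹_› ‹_› ‹_› ‹_› ‹_›
      | exact g2 ‹_› ‹_› ‹_› ‹_› ‹_›
      | exact g3 ‹_› ‹_› ‹_› ‹_› ‹_›
      | exact g4 ‹_› ‹_› ‹_› ‹_› ‹_›

/-- dense pairs have the same colour at every common neighbour -/
lemma dense_same {S : Finset V} {c : V → V → ℕ} (hG : Good G 7 S) (h : LCol G S 2 c)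
    {u v x : V} (hu : u ∈ S) (hv : v ∈ S) (hx : x ∈ S) (d : Dn G S u v) (xu : G.Adj x u)
    (xv : G.Adj x v) : c x u = c x v := by
  by_contra hne
  obtain ⟨s, hs, t, ht, us, st, tv⟩ := dist3 (good_nb (d := 4) hG hx) (h x hx)
    (mem_nb.2 ⟨hu, xu⟩) (mem_nb.2 ⟨hv, xv⟩) hne
  rw [mem_nb] at hs ht
  exact spindle hG h hv hu ht.1 d.symm
    ⟨s, hs.1, x, hx, hs.2.symm, us.symm, st, xu, ht.2⟩ tv.symm

lemma four_cycle {S : Finset V} (hG : Good G 7 S) {u v x y : V} (hu : u ∈ S) (hv : v ∈ S)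
    (hx : x ∈ S) (hy : y ∈ S) (xu : G.Adj x u) (xv : G.Adj x v) (yu : G.Adj y u)
    (yv : G.Adj y v) : Dn G S u v ∨ Dn G S x y := by
  classical
  obtain ⟨s, hs, hh⟩ := pigeon hG [(1, u), (1, v), (1, x), (1, y)]
    (by simp [hu, hv, hx, hy]) (by simp)
  have f1 : G.Adj s u → G.Adj s v → G.Adj s x → Dn G S u v := fun a b c =>
    ⟨s, hs, x, hx, c, a, b, xu, xv⟩
  have f2 : G.Adj s u → G.Adj s v → G.Adj s y → Dn G S u v := fun a b c =>
    ⟨s, hs, y, hy, c, a, b, yu, yv⟩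
  have f3 : G.Adj s x → G.Adj s y → G.Adj s u → Dn G S x y := fun a b c =>
    ⟨s, hs, u, hu, c, a, b, xu.symm, yu.symm⟩
  have f4 : G.Adj s x → G.Adj s y → G.Adj s v → Dn G S x y := fun a b c =>
    ⟨s, hs, v, hv, c, a, b, xv.symm, yv.symm⟩
  simp only [List.map_cons, List.map_nil, List.sum_cons, List.sum_nil] at hh
  split_ifs at hh <;> first | (exfalso; omega) | exact Or.inl (f1 ‹_› ‹_› ‹_›) | exact Or.inl (f2 ‹_› ‹_› ‹_›) | exact Or.inr (f3 ‹_› ‹_› ‹_›) | exact Or.inr (f4 ‹_› ‹_› ‹_›)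

/-- if `x, y` differ at one vertex `b`, no vertex is adjacent to `a, x, y` -/
lemma no_three {S : Finset V} {c : V → V → ℕ} (hG : Good G 7 S) (h : LCol G S 2 c)
    {a b x y s : V} (ha : a ∈ S) (hb : b ∈ S) (hx : x ∈ S) (hy : y ∈ S) (hs : s ∈ S)
    (ax : G.Adj a x) (ay : G.Adj a y) (bx : G.Adj b x) (yb : G.Adj b y) (e : c b x ≠ c b y)
    (sa : G.Adj s a) (sx : G.Adj s x) (sy : G.Adj s y) : False :=
  e (dense_same hG h hx hy hb ⟨s, hs, a, ha, sa, sx, sy, ax, ay⟩ bx yb)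

lemma claimN_aux {S : Finset V} {c : V → V → ℕ} (hG : Good G 7 S) (h : LCol G S 2 c)
    {a b x y : V} (ha : a ∈ S) (hb : b ∈ S) (hx : x ∈ S) (hy : y ∈ S)
    (ax : G.Adj a x) (ay : G.Adj a y) (bx : G.Adj b x) (yb : G.Adj b y)
    (e1 : c a x = c a y) (e2 : c b x ≠ c b y)
    (hn : ∀ s ∈ S, G.Adj s a → G.Adj s b → G.Adj s y → False) : False := by
  classical
  have n1 : ∀ s ∈ S, G.Adj s a → G.Adj s x → G.Adj s y → False := fun s hs =>
    no_three hG h ha hb hx hy hs ax ay bx yb e2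
  have n2 : ∀ s ∈ S, G.Adj s b → G.Adj s x → G.Adj s y → False := fun s hs =>
    no_three hG h hb hb hx hy hs bx yb bx yb e2
  obtain ⟨z, hz, hh⟩ := pigeon hG [(1, a), (1, b), (1, x), (1, y)]
    (by simp [ha, hb, hx, hy]) (by simp)
  have hz3 : G.Adj z a ∧ G.Adj z b ∧ G.Adj z x := by
    have f1 := hn z hz
    have f2 := n1 z hz
    have f3 := n2 z hz
    clear hn n1 n2
    simp only [List.map_cons, List.map_nil, List.sum_cons, List.sum_nil] at hh
    split_ifs at hh <;> first | (exfalso; omega) | exact ⟨‹_›, ‹_›, ‹_›⟩ | exact (f1 ‹_› ‹_› ‹_›).elim | exact (f2 ‹_› ‹_› ‹_›).elim | exact (f3 ‹_› ‹_› ‹_›).elim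
  obtain ⟨za, zb, zx⟩ := hz3
  have e3 : c a z ≠ c a y := by
    rw [← e1]
    exact adj_ne (h a ha) (mem_nb.2 ⟨hz, za.symm⟩) (mem_nb.2 ⟨hx, ax⟩) zx
  obtain ⟨s, hs, hh⟩ := pigeon hG [(3, a), (3, b), (4, y), (2, x), (2, z)]
    (by simp [ha, hb, hx, hy, hz]) (by simp)
  have f1 := hn s hs
  have f2 := n1 s hs
  have f3 := n2 s hs
  have f4 : G.Adj s a → G.Adj s z → G.Adj s y → False :=
    no_three hG h ha ha hz hy hs za.symm ay za.symm ay e3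
  have f5 : G.Adj s b → G.Adj s z → G.Adj s y → False :=
    no_three hG h hb ha hz hy hs zb.symm yb za.symm ay e3
  have f6 : G.Adj s a → G.Adj s x → G.Adj s z → False := noK4 h hs ha hx hz ax za.symm zx.symm
  have f7 : G.Adj s b → G.Adj s x → G.Adj s z → False := noK4 h hs hb hx hz bx zb.symm zx.symm
  clear hn n1 n2
  simp only [List.map_cons, List.map_nil, List.sum_cons, List.sum_nil] at hh
  split_ifs at hh <;> first
      | (exfalso; omega)
      | exact f1 ‹_› ‹_› ‹_›
      | exact f2 ‹_› ‹_› ‹_›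
      | exact f3 ‹_› ‹_› ‹_›
      | exact f4 ‹_› ‹_› ‹_›
      | exact f5 ‹_› ‹_› ‹_›
      | exact f6 ‹_› ‹_› ‹_›
      | exact f7 ‹_› ‹_› ‹_›

lemma claimN {S : Finset V} {c : V → V → ℕ} (hG : Good G 7 S) (h : LCol G S 2 c)
    {a b x y : V} (ha : a ∈ S) (hb : b ∈ S) (hx : x ∈ S) (hy : y ∈ S)
    (ax : G.Adj a x) (ay : G.Adj a y) (bx : G.Adj b x) (yb : G.Adj b y)
    (e1 : c a x = c a y) : c b x = c b y := by
  classical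
  by_contra e2
  by_cases h1 : ∃ s ∈ S, G.Adj s a ∧ G.Adj s b ∧ G.Adj s y
  swap
  · exact claimN_aux hG h ha hb hx hy ax ay bx yb e1 e2 (fun s hs p q r => h1 ⟨s, hs, p, q, r⟩)
  by_cases h2 : ∃ s ∈ S, G.Adj s a ∧ G.Adj s b ∧ G.Adj s x
  swap
  · exact claimN_aux hG h ha hb hy hx ay ax yb bx e1.symm (Ne.symm e2)
      (fun s hs p q r => h2 ⟨s, hs, p, q, r⟩)
  obtain ⟨t, ht, ta, tb, ty⟩ := h1
  obtain ⟨z, hz, za, zb, zx⟩ := h2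
  have hca := h a ha
  have hcb := h b hb
  have xa' := mem_nb.2 ⟨hx, ax⟩
  have ya' := mem_nb.2 ⟨hy, ay⟩
  have za' := mem_nb.2 ⟨hz, za.symm⟩
  have ta' := mem_nb.2 ⟨ht, ta.symm⟩
  have xb' := mem_nb.2 ⟨hx, bx⟩
  have yb' := mem_nb.2 ⟨hy, yb⟩
  have zb' := mem_nb.2 ⟨hz, zb.symm⟩
  have tb' := mem_nb.2 ⟨ht, tb.symm⟩
  have e3 : c a z ≠ c a y := by rw [← e1]; exact adj_ne hca za' xa' zx
  have e4 : c a x ≠ c a t := by rw [e1]; exact (adj_ne hca ta' ya' ty).symm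
  have e5 : c b z ≠ c b t := by
    have q1 := two_col hcb xb' zb' yb' (adj_ne hcb zb' xb' zx).symm e2
    rw [q1]
    exact (adj_ne hcb tb' yb' ty).symm
  obtain ⟨s, hs, hh⟩ := pigeon hG [(3, a), (3, b), (2, x), (2, y), (2, z), (2, t)]
    (by simp [ha, hb, hx, hy, hz, ht]) (by simp)
  have f1 : G.Adj s a → G.Adj s x → G.Adj s y → False :=
    no_three hG h ha hb hx hy hs ax ay bx yb e2
  have f2 : G.Adj s b → G.Adj s x → G.Adj s y → False :=
    no_three hG h hb hb hx hy hs bx yb bx yb e2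
  have f3 : G.Adj s a → G.Adj s z → G.Adj s y → False :=
    no_three hG h ha ha hz hy hs za.symm ay za.symm ay e3
  have f4 : G.Adj s b → G.Adj s z → G.Adj s y → False :=
    no_three hG h hb ha hz hy hs zb.symm yb za.symm ay e3
  have f5 : G.Adj s a → G.Adj s x → G.Adj s t → False :=
    no_three hG h ha ha hx ht hs ax ta.symm ax ta.symm e4
  have f6 : G.Adj s b → G.Adj s x → G.Adj s t → False :=
    no_three hG h hb ha hx ht hs bx tb.symm ax ta.symm e4
  have f7 : G.Adj s a → G.Adj s z → G.Adj s t → False :=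
    no_three hG h ha hb hz ht hs za.symm ta.symm zb.symm tb.symm e5
  have f8 : G.Adj s b → G.Adj s z → G.Adj s t → False :=
    no_three hG h hb hb hz ht hs zb.symm tb.symm zb.symm tb.symm e5
  have g1 : G.Adj s a → G.Adj s x → G.Adj s z → False := noK4 h hs ha hx hz ax za.symm zx.symm
  have g2 : G.Adj s b → G.Adj s x → G.Adj s z → False := noK4 h hs hb hx hz bx zb.symm zx.symm
  have g3 : G.Adj s a → G.Adj s y → G.Adj s t → False := noK4 h hs ha hy ht ay ta.symm ty.symm
  have g4 : G.Adj s b → G.Adj s y → G.Adj s t → False := noK4 h hs hb hy ht yb tb.symm ty.symm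
  simp only [List.map_cons, List.map_nil, List.sum_cons, List.sum_nil] at hh
  split_ifs at hh <;> first
      | (exfalso; omega)
      | exact f1 ‹_› ‹_› ‹_›
      | exact f2 ‹_› ‹_› ‹_›
      | exact f3 ‹_› ‹_› ‹_›
      | exact f4 ‹_› ‹_› ‹_›
      | exact f5 ‹_› ‹_› ‹_›
      | exact f6 ‹_› ‹_› ‹_›
      | exact f7 ‹_› ‹_› ‹_›
      | exact f8 ‹_› ‹_› ‹_›
      | exact g1 ‹_› ‹_› ‹_›
      | exact g2 ‹_› ‹_› ‹_›
      | exact g3 ‹_› ‹_› ‹_›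
      | exact g4 ‹_› ‹_› ‹_›

lemma well_two {S : Finset V} {c : V → V → ℕ} (hG : Good G 7 S)
    (h : LCol G S 2 c) : Well G S c := by
  intro u hu v hv x hx y hy xu xv yu yv ex
  rcases four_cycle hG hu hv hx hy xu xv yu yv with hd | _
  · exact dense_same hG h hu hv hy hd yu yv
  · exact claimN hG h hx hy hu hv xu xv yu yv ex

/-- transitivity, base case: the central configuration -/
lemma t1 {S : Finset V} {c : V → V → ℕ} (h : LCol G S 2 c) (hW : Well G S c)
    {u v w t t' t'' : V} (hu : u ∈ S) (hv : v ∈ S) (hw : w ∈ S) (ht : t ∈ S) (ht' : t' ∈ S)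
    (ht'' : t'' ∈ S) (tv : G.Adj t v) (t'v : G.Adj t' v) (t'w : G.Adj t' w)
    (tu : G.Adj t u) (t''u : G.Adj t'' u) (t''w : G.Adj t'' w) (tt' : G.Adj t t')
    (tt'' : G.Adj t t'') (e1 : c t' v = c t' w) (e2 : c t'' u ≠ c t'' w) : False := by
  have hc' := h t' ht'
  have hc'' := h t'' ht''
  have q1 : c t' t ≠ c t' w := by
    rw [← e1]
    exact adj_ne hc' (mem_nb.2 ⟨ht, tt'.symm⟩) (mem_nb.2 ⟨hv, t'v⟩) tv
  have q2 : c t'' t ≠ c t'' w := fun e =>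
    q1 (hW t ht w hw t'' ht'' t' ht' tt''.symm t''w tt'.symm t'w e)
  have a1 := mem_nb.2 ⟨ht, tt''.symm⟩
  have a2 := mem_nb.2 ⟨hu, t''u⟩
  have a3 := mem_nb.2 ⟨hw, t''w⟩
  exact e2 (two_col hc'' a1 a2 a3 (adj_ne hc'' a1 a2 tu) q2)

lemma trans_two {S : Finset V} {c : V → V → ℕ} (hG : Good G 7 S)
    (h : LCol G S 2 c) (hW : Well G S c) : Trans G S c := by
  classical
  intro u hu v hv w hw r1 r2
  by_contra r3
  have huv : ∀ t ∈ S, G.Adj t u → G.Adj t v → c t u = c t v := by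
    obtain ⟨x, hx, a, b, e⟩ := r1
    exact fun t ht p q => hW u hu v hv x hx t ht a b p q e
  have hvw : ∀ t ∈ S, G.Adj t v → G.Adj t w → c t v = c t w := by
    obtain ⟨x, hx, a, b, e⟩ := r2
    exact fun t ht p q => hW v hv w hw x hx t ht a b p q e
  have huw : ∀ t ∈ S, G.Adj t u → G.Adj t w → c t u ≠ c t w :=
    fun t ht p q e => r3 ⟨t, ht, p, q, e⟩
  have h3 : ∀ t ∈ S, G.Adj t u → G.Adj t v → G.Adj t w → False := fun t ht p q r =>
    huw t ht p r ((huv t ht p q).trans (hvw t ht q r))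
  -- no edges between `K_uv` and `K_vw`
  have hii : ∀ t ∈ S, ∀ t' ∈ S, G.Adj t u → G.Adj t v → G.Adj t' v → G.Adj t' w →
      G.Adj t t' → False := by
    intro t ht t' ht' tu tv t'v t'w tt'
    obtain ⟨s, hs, hh⟩ := pigeon hG [(2, u), (2, w), (1, v), (1, t), (1, t')]
      (by simp [hu, hv, hw, ht, ht']) (by simp)
    have f1 := h3 s hs
    have f2 : G.Adj s u → G.Adj s w → G.Adj s t → False := fun a b d =>
      t1 h hW hu hv hw ht ht' hs tv t'v t'w tu a b tt' d.symm (hvw t' ht' t'v t'w) (huw s hs a b)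
    have f3 : G.Adj s u → G.Adj s w → G.Adj s t' → False := fun a b d =>
      t1 h hW hw hv hu ht' ht hs t'v tv tu t'w b a tt'.symm d.symm (huv t ht tu tv).symm
        (huw s hs a b).symm
    have f4 : G.Adj s v → G.Adj s t → G.Adj s t' → False := noK4 h hs hv ht ht' tv.symm t'v.symm tt'
    clear huv hvw huw h3 r1 r2 r3
    simp only [List.map_cons, List.map_nil, List.sum_cons, List.sum_nil] at hh
    split_ifs at hh <;> first
        | (exfalso; omega)
        | exact f1 ‹_› ‹_› ‹_›
        | exact f2 ‹_› ‹_› ‹_›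
        | exact f3 ‹_› ‹_› ‹_›
        | exact f4 ‹_› ‹_› ‹_›
  -- a vertex of `K_uw` with a neighbour in `K_uv` has one in `K_vw`, and conversely
  have hA : ∀ t'' ∈ S, G.Adj t'' u → G.Adj t'' w → ∀ t ∈ S, G.Adj t u → G.Adj t v →
      G.Adj t t'' → ∃ t' ∈ S, G.Adj t' v ∧ G.Adj t' w ∧ G.Adj t' t'' := by
    intro t'' ht'' t''u t''w t ht tu tv tt''
    by_contra hcon
    obtain ⟨s, hs, hh⟩ := pigeon hG [(2, v), (2, w), (1, u), (1, t), (1, t'')]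
      (by simp [hu, hv, hw, ht, ht'']) (by simp)
    have f1 := h3 s hs
    have f2 : G.Adj s v → G.Adj s w → G.Adj s t → False := fun a b d =>
      hii t ht s hs tu tv a b d.symm
    have f3 : G.Adj s v → G.Adj s w → G.Adj s t'' → False := fun a b d =>
      hcon ⟨s, hs, a, b, d⟩
    have f4 : G.Adj s u → G.Adj s t → G.Adj s t'' → False :=
      noK4 h hs hu ht ht'' tu.symm t''u.symm tt''
    clear huv hvw huw h3 r1 r2 r3 hii hcon
    simp only [List.map_cons, List.map_nil, List.sum_cons, List.sum_nil] at hh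
    split_ifs at hh <;> first
        | (exfalso; omega)
        | exact f1 ‹_› ‹_› ‹_›
        | exact f2 ‹_› ‹_› ‹_›
        | exact f3 ‹_› ‹_› ‹_›
        | exact f4 ‹_› ‹_› ‹_›
  have hB : ∀ t'' ∈ S, G.Adj t'' u → G.Adj t'' w → ∀ t ∈ S, G.Adj t u → G.Adj t v →
      G.Adj t t'' → ∀ t' ∈ S, G.Adj t' v → G.Adj t' w → G.Adj t' t'' → False := by
    intro t'' ht'' t''u t''w t ht tu tv tt'' t' ht' t'v t'w tt3
    have hc := h t'' ht''
    have mu := mem_nb.2 ⟨hu, t''u⟩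
    have mw := mem_nb.2 ⟨hw, t''w⟩
    have mt := mem_nb.2 ⟨ht, tt''.symm⟩
    have mt' := mem_nb.2 ⟨ht', tt3.symm⟩
    have e0 := huw t'' ht'' t''u t''w
    have e1 : c t'' t ≠ c t'' t' := by
      have q1 := two_col hc mu mt mw (adj_ne hc mt mu tu).symm e0
      rw [q1]
      exact (adj_ne hc mt' mw t'w).symm
    obtain ⟨s, hs, hh⟩ := pigeon hG [(1, u), (1, w), (2, v), (1, t), (1, t'), (1, t'')]
      (by simp [hu, hv, hw, ht, ht', ht'']) (by simp)
    have f1 := h3 s hs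
    have f2 : G.Adj s u → G.Adj s v → G.Adj s t' → False := fun a b d =>
      hii s hs t' ht' a b t'v t'w d
    have f3 : G.Adj s v → G.Adj s w → G.Adj s t → False := fun a b d =>
      hii t ht s hs tu tv a b d.symm
    have f4 : G.Adj s u → G.Adj s t → G.Adj s t'' → False :=
      noK4 h hs hu ht ht'' tu.symm t''u.symm tt''
    have f5 : G.Adj s w → G.Adj s t' → G.Adj s t'' → False :=
      noK4 h hs hw ht' ht'' t'w.symm t''w.symm tt3
    have f6 : G.Adj s v → G.Adj s t → G.Adj s t' → False := by
      intro a b d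
      have hcs := h s hs
      have sv := mem_nb.2 ⟨hv, a⟩
      have st := mem_nb.2 ⟨ht, b⟩
      have st' := mem_nb.2 ⟨ht', d⟩
      have q := two_col hcs sv st st' (adj_ne hcs sv st tv.symm) (adj_ne hcs sv st' t'v.symm)
      exact e1 (hW t ht t' ht' s hs t'' ht'' b d tt''.symm tt3.symm q)
    clear huv hvw huw h3 r1 r2 r3 hii hA
    simp only [List.map_cons, List.map_nil, List.sum_cons, List.sum_nil] at hh
    split_ifs at hh <;> first
        | (exfalso; omega)
        | exact f1 ‹_› ‹_› ‹_›
        | exact f2 ‹_› ‹_› ‹_›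
        | exact f3 ‹_› ‹_› ‹_›
        | exact f4 ‹_› ‹_› ‹_›
        | exact f5 ‹_› ‹_› ‹_›
        | exact f6 ‹_› ‹_› ‹_›
  have hC : ∀ t'' ∈ S, G.Adj t'' u → G.Adj t'' w → ∀ t ∈ S, G.Adj t u → G.Adj t v →
      G.Adj t t'' → False := by
    intro t'' ht'' t''u t''w t ht tu tv tt''
    obtain ⟨t', ht', a, b, d⟩ := hA t'' ht'' t''u t''w t ht tu tv tt''
    exact hB t'' ht'' t''u t''w t ht tu tv tt'' t' ht' a b d
  -- conclude inside `K_uv`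
  obtain ⟨t, ht, tu, tv⟩ := common2 hG (by norm_num) hu hv
  obtain ⟨p, hp, hh⟩ := pigeon hG [(1, u), (1, v), (1, w), (1, t)]
    (by simp [hu, hv, hw, ht]) (by simp)
  have hp3 : G.Adj p u ∧ G.Adj p v ∧ G.Adj p t := by
    have f1 := h3 p hp
    have f2 : G.Adj p v → G.Adj p w → G.Adj p t → False := fun a b d =>
      hii t ht p hp tu tv a b d.symm
    have f3 : G.Adj p u → G.Adj p w → G.Adj p t → False := fun a b d =>
      hC p hp a b t ht tu tv d.symm
    clear huv hvw huw h3 r1 r2 r3 hii hA hB hC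
    simp only [List.map_cons, List.map_nil, List.sum_cons, List.sum_nil] at hh
    split_ifs at hh <;> first
        | (exfalso; omega)
        | exact ⟨‹_›, ‹_›, ‹_›⟩
        | exact (f1 ‹_› ‹_› ‹_›).elim
        | exact (f2 ‹_› ‹_› ‹_›).elim
        | exact (f3 ‹_› ‹_› ‹_›).elim
  obtain ⟨pu, pv, pt⟩ := hp3
  obtain ⟨s, hs, hh⟩ := pigeon hG [(3, u), (3, v), (4, w), (2, t), (2, p)]
    (by simp [hu, hv, hw, ht, hp]) (by simp)
  have f1 := h3 s hs
  have f2 : G.Adj s v → G.Adj s w → G.Adj s t → False := fun a b d =>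
    hii t ht s hs tu tv a b d.symm
  have f3 : G.Adj s u → G.Adj s w → G.Adj s t → False := fun a b d =>
    hC s hs a b t ht tu tv d.symm
  have f4 : G.Adj s v → G.Adj s w → G.Adj s p → False := fun a b d =>
    hii p hp s hs pu pv a b d.symm
  have f5 : G.Adj s u → G.Adj s w → G.Adj s p → False := fun a b d =>
    hC s hs a b p hp pu pv d.symm
  have f6 : G.Adj s u → G.Adj s t → G.Adj s p → False := noK4 h hs hu ht hp tu.symm pu.symm pt.symm
  have f7 : G.Adj s v → G.Adj s t → G.Adj s p → False := noK4 h hs hv ht hp tv.symm pv.symm pt.symm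
  clear huv hvw huw h3 r1 r2 r3 hii hA hB hC
  simp only [List.map_cons, List.map_nil, List.sum_cons, List.sum_nil] at hh
  split_ifs at hh <;> first
      | (exfalso; omega)
      | exact f1 ‹_› ‹_› ‹_›
      | exact f2 ‹_› ‹_› ‹_›
      | exact f3 ‹_› ‹_› ‹_›
      | exact f4 ‹_› ‹_› ‹_›
      | exact f5 ‹_› ‹_› ‹_›
      | exact f6 ‹_› ‹_› ‹_›
      | exact f7 ‹_› ‹_› ‹_›

/-- locally `(k+2)`-partite implies `(k+3)`-colourable -/
lemma main_local {S : Finset V} {k : ℕ} {c : V → V → ℕ} (hG : Good G (3 * k + 7) S)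
    (h : LCol G S (k + 2) c) : ∃ f : V → ℕ, Col G S (k + 3) f := by
  rcases k with _ | _ | k
  · have hW : Well G S c := well_two hG h
    exact finish hG h hW (trans_two hG h hW)
  · have hW : Well G S c := well_three hG h
    exact finish hG h hW (trans_of_well hG (by norm_num) hW)
  · have hW : Well G S c := well_big (by omega) hG h
    exact finish hG h hW (trans_of_well hG (by omega) hW)

open Classical in
lemma main_ind (a : ℕ) : ∀ S : Finset V, Good G (3 * a + 4) S →
    (∀ Q : Finset V, Q ⊆ S → G.IsNClique a Q →
      ∃ f : V → ℕ, Col G (S.filter (fun v => ∀ u ∈ Q, G.Adj u v)) 2 f) →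
    ∃ f : V → ℕ, Col G S (a + 2) f := by
  induction a with
  | zero =>
    intro S _ h
    obtain ⟨f, hf⟩ := h ∅ (by simp) (by simp [SimpleGraph.isNClique_iff])
    exact ⟨f, col_mono hf (fun v hv => by simpa using hv)⟩
  | succ a ih =>
    intro S hG h
    have hx : ∀ x : V, ∃ f : V → ℕ, x ∈ S → Col G (nb G S x) (a + 2) f := by
      intro x
      by_cases hx : x ∈ S
      swap
      · exact ⟨fun _ => 0, fun h => absurd h hx⟩
      obtain ⟨f, hf⟩ := ih (nb G S x) (good_nb (d := 3 * a + 4) hG hx) (by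
        intro Q hQ hcl
        have hadj : ∀ b ∈ Q, G.Adj x b := fun b hb => (mem_nb.1 (hQ hb)).2
        obtain ⟨f, hf⟩ := h (insert x Q) (by
          intro y hy
          rcases Finset.mem_insert.1 hy with rfl | hy
          · exact hx
          · exact (mem_nb.1 (hQ hy)).1) (hcl.insert hadj)
        refine ⟨f, col_mono hf ?_⟩
        intro v hv
        simp only [Finset.mem_filter, mem_nb, Finset.mem_insert] at hv ⊢
        refine ⟨hv.1.1, ?_⟩
        rintro u (rfl | hu)
        · exact hv.1.2
        · exact hv.2 u hu)
      exact ⟨f, fun _ => hf⟩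
    choose c hc using hx
    exact main_local (k := a) hG hc

end LB

/-- An `a`-locally bipartite graph on `n` vertices with minimum degree strictly greater
than `(1 - 1/(a + 4/3)) * n` is `(a + 2)`-colourable. -/
theorem statement13 {V : Type*} [Fintype V] (a : ℕ) (ha : 1 ≤ a)
    (G : SimpleGraph V) [DecidableRel G.Adj] (hlb : LocallyBip a G)
    (hdeg : (1 - 1 / ((a : ℝ) + 4 / 3)) * (Fintype.card V : ℝ) < (G.minDegree : ℝ)) :
    G.Colorable (a + 2) := by
  classical
  have hG : LB.Good G (3 * a + 4) Finset.univ := by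
    intro v _
    have h1 : (Finset.univ.filter (fun w => G.Adj v w)).card
        + (Finset.univ.filter (fun w => ¬ G.Adj v w)).card = Fintype.card V := by
      rw [← Finset.card_univ]
      convert Finset.card_filter_add_card_filter_not (s := (Finset.univ : Finset V))
        (fun w => G.Adj v w) using 2
    have h2 : (Finset.univ.filter (fun w => G.Adj v w)).card = G.degree v := by
      rw [← SimpleGraph.card_neighborFinset_eq_degree, SimpleGraph.neighborFinset_eq_filter]
    have h3 : G.minDegree ≤ G.degree v := G.minDegree_le_degree v
    have h4 : (G.minDegree : ℝ) + ((Finset.univ.filter (fun w => ¬ G.Adj v w)).card : ℝ)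
        ≤ Fintype.card V := by
      exact_mod_cast (by omega : G.minDegree
        + (Finset.univ.filter (fun w => ¬ G.Adj v w)).card ≤ Fintype.card V)
    have hpos : (0 : ℝ) < (a : ℝ) + 4 / 3 := by positivity
    have h5 : ((Finset.univ.filter (fun w => ¬ G.Adj v w)).card : ℝ)
        < 1 / ((a : ℝ) + 4 / 3) * Fintype.card V := by linarith
    rw [div_mul_eq_mul_div, lt_div_iff₀ hpos] at h5
    have h6 : (3 * (a : ℝ) + 4) * ((Finset.univ.filter (fun w => ¬ G.Adj v w)).card : ℝ)
        < 3 * Fintype.card V := by linarith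
    rw [Finset.card_univ]
    have h8 : (3 * a + 4) * (Finset.univ.filter (fun w => ¬ G.Adj v w)).card
        < 3 * Fintype.card V := by exact_mod_cast h6
    convert h8
  obtain ⟨f, K, k1, k2, k3⟩ := LB.main_ind (G := G) a Finset.univ hG (by
    intro Q _ hQ
    obtain ⟨C⟩ := hlb Q hQ
    refine ⟨fun v => if hv : ∀ u ∈ Q, G.Adj u v then (C ⟨v, hv⟩ : Fin 2).val else 0,
      Finset.range 2, by simp, ?_, ?_⟩
    · intro u _
      dsimp only
      split_ifs
      · simp only [Finset.mem_range]; exact (C _).isLt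
      · simp
    · intro u hu v hv huv
      have hu' : ∀ y ∈ Q, G.Adj y u := by
        simp only [Finset.mem_filter] at hu
        exact hu.2
      have hv' : ∀ y ∈ Q, G.Adj y v := by
        simp only [Finset.mem_filter] at hv
        exact hv.2
      simp only [dif_pos hu', dif_pos hv']
      intro e
      exact C.valid (v := ⟨u, hu'⟩) (w := ⟨v, hv'⟩) huv (Fin.ext e))
  have C : G.Coloring K := SimpleGraph.Coloring.mk (fun v => ⟨f v, k2 v (Finset.mem_univ v)⟩)
    (by
      intro u v huv e
      exact k3 u (Finset.mem_univ u) v (Finset.mem_univ v) huv (congrArg Subtype.val e))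
  have h7 := C.colorable
  rw [Fintype.card_coe] at h7
  exact h7.mono k1
end
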